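/- arXiv:1902.03441 — 2 statements merged into one kernel-verified Lean document; each statement's English description precedes it below -/
import Mathlib

section
/- Let μ be an ergodic shift-invariant probability measure on X = A^ℕ. Then for every q ∈ ℝ one has q·h(μ) ≤ liminf_{n→∞} (1/n) log ∬ T_{x_1^n}(y)^q d(μ⊗μ)(x,y). -/
open MeasureTheory Filter Topology Set

namespace RTSpec

variable (A : Type*) [Fintype A] [TopologicalSpace A] [DiscreteTopology A]
  [MeasurableSpace A] [BorelSpace A]

/-- The sequence space `X = A^ℕ` (0-indexed: `x 0` is the paper's `x₁`). -/
abbrev X := ℕ → A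

/-- The shift map `θ`. -/
def shift : X A → X A := fun x n => x (n + 1)

/-- The cylinder `[a_1^n]` based on the word `w = a_1^n`. -/
def cyl {n : ℕ} (w : Fin n → A) : Set (X A) := {x | ∀ i : Fin n, x i.val = w i}

/-- Return time `R_n(x) = inf {k ≥ 2 : x_k^{k+n-1} = x_1^n}` (with `sInf ∅ = 0`). -/
noncomputable def retTime (n : ℕ) (x : X A) : ℕ := sInf {k | 2 ≤ k ∧ ∀ i < n, x (k - 1 + i) = x i}

/-- Hitting time `T_{a_1^n}(y) = inf {k ≥ 1 : y_k^{k+n-1} = a_1^n}`. -/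
noncomputable def hitTime {n : ℕ} (w : Fin n → A) (y : X A) : ℕ :=
  sInf {k | 1 ≤ k ∧ ∀ i : Fin n, y (k - 1 + i.val) = w i}

/-- Hitting/return time in the shifted sense: `inf {k ≥ 1 : θ^k y ∈ [a_1^n]}`. -/
noncomputable def hitTime' {n : ℕ} (w : Fin n → A) (y : X A) : ℕ :=
  sInf {k | 1 ≤ k ∧ ∀ i : Fin n, y (k + i.val) = w i}

/-- `τ(a_1^n) = inf {k ≥ 1 : [a_1^n] ∩ θ^{-k}[a_1^n] ≠ ∅}`, the smallest return time
of the cylinder `[a_1^n]`. -/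
noncomputable def tau {n : ℕ} (w : Fin n → A) : ℕ :=
  sInf {k | 1 ≤ k ∧ (cyl A w ∩ {y | ∀ i : Fin n, y (k + i.val) = w i}).Nonempty}

/-- `ζ_μ(a_1^n) = μ([a_1^n] ∩ {T_{a_1^n} ≠ τ(a_1^n)}) / μ([a_1^n])`. -/
noncomputable def zeta (μ : Measure (X A)) {n : ℕ} (w : Fin n → A) : ℝ :=
  (μ (cyl A w ∩ {y | hitTime' A w y ≠ tau A w})).toReal / (μ (cyl A w)).toReal

/-- A shift-invariant Borel probability measure. -/
def InvProb (η : Measure (X A)) : Prop :=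
  IsProbabilityMeasure η ∧ Measure.map (shift A) η = η

/-- The `n`-th term `-(1/n) Σ_{a_1^n} μ(a_1^n) log μ(a_1^n)` of the entropy sequence. -/
noncomputable def entSeq (μ : Measure (X A)) (n : ℕ) : ℝ :=
  -(1 / (n : ℝ)) * ∑ w : Fin n → A, (μ (cyl A w)).toReal * Real.log (μ (cyl A w)).toReal

/-- The entropy `h(μ)`, i.e. the limit of `entSeq` (which always exists for a
shift-invariant measure; we realize it as a liminf). -/
noncomputable def entropy (μ : Measure (X A)) : ℝ := atTop.liminf (entSeq A μ)

/-- Topological pressure `P(ψ) = sup_η {h(η) + ∫ ψ dη}`, the supremum running over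
all shift-invariant probability measures. -/
noncomputable def pressure (ψ : X A → ℝ) : ℝ :=
  sSup {r | ∃ η : Measure (X A), InvProb A η ∧ r = entropy A η + ∫ x, ψ x ∂η}

/-- `sup_η ∫ φ dη` over shift-invariant probability measures. -/
noncomputable def supInt (φ : X A → ℝ) : ℝ :=
  sSup {r | ∃ η : Measure (X A), InvProb A η ∧ r = ∫ x, φ x ∂η}

/-- `inf_η ∫ φ dη` over shift-invariant probability measures. -/
noncomputable def infInt (φ : X A → ℝ) : ℝ :=
  sInf {r | ∃ η : Measure (X A), InvProb A η ∧ r = ∫ x, φ x ∂η}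

/-- `var_n(φ) = sup {|φ(x) - φ(y)| : x_1^n = y_1^n}`. -/
noncomputable def Var (φ : X A → ℝ) (n : ℕ) : ℝ :=
  sSup {r | ∃ x y : X A, (∀ i < n, x i = y i) ∧ r = |φ x - φ y|}

/-- Prepending a symbol: `ax = (a, x_1, x_2, …)`. -/
def prepend (a : A) (x : X A) : X A := fun n => Nat.casesOn n a x

/-- A potential `φ` is normalized if `Σ_{a ∈ A} e^{φ(ax)} = 1` for all `x`. -/
def Normalized (φ : X A → ℝ) : Prop :=
  ∀ x : X A, ∑ a : A, Real.exp (φ (prepend A a x)) = 1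

/-- `μ` is an equilibrium state for `φ`: a probability measure fixed by the dual
transfer operator, i.e. `∫ L_φ f dμ = ∫ f dμ` for every continuous `f`. -/
def IsEqSt (φ : X A → ℝ) (μ : Measure (X A)) : Prop :=
  IsProbabilityMeasure μ ∧ ∀ f : X A → ℝ, Continuous f →
    ∫ x, (∑ a : A, Real.exp (φ (prepend A a x)) * f (prepend A a x)) ∂μ = ∫ x, f x ∂μ

/-- The `n`-th term `(1/n) log ∫ R_n^q dμ` of the return-time `L^q`-spectrum,
with values in `EReal` (the integral may be infinite). -/
noncomputable def RSeq (μ : Measure (X A)) (q : ℝ) (n : ℕ) : EReal :=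
  (((n : ℝ)⁻¹ : ℝ) : EReal) *
    ENNReal.log (∫⁻ x, ENNReal.ofReal ((retTime A n x : ℝ) ^ q) ∂μ)

/-- The `n`-th term `(1/n) log Σ_{a_1^n} μ(a_1^n)^{1-q}` of the `L^q`-spectrum of `μ`. -/
noncomputable def MSeq (μ : Measure (X A)) (q : ℝ) (n : ℕ) : ℝ :=
  (1 / (n : ℝ)) * Real.log (∑ w : Fin n → A, (μ (cyl A w)).toReal ^ (1 - q))

/-- `Λ^{(n)}(μ) = (1/n) log Σ_{a_1^n} (1 - ζ_μ(a_1^n)) μ(a_1^n)`. -/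
noncomputable def LamSeq (μ : Measure (X A)) (n : ℕ) : ℝ :=
  (1 / (n : ℝ)) * Real.log (∑ w : Fin n → A, (1 - zeta A μ w) * (μ (cyl A w)).toReal)

/-- `(1/n) log max_{a_1^n} μ(a_1^n)`. -/
noncomputable def gammaSeq (μ : Measure (X A)) (n : ℕ) : ℝ :=
  (1 / (n : ℝ)) * Real.log (⨆ w : Fin n → A, (μ (cyl A w)).toReal)

/-- `μ` is φ-mixing with rate `ϕ`: `ϕ` decreases to `0` and for all `n, ℓ ≥ 1`,
all `S` in the σ-algebra generated by coordinates `1, …, n` with `μ S ≠ 0`, and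
all `T` in the σ-algebra generated by coordinates `n+ℓ, n+ℓ+1, …`,
`|μ(S ∩ T)/μ(S) - μ(T)| ≤ ϕ(ℓ)`. -/
def PhiMixing (μ : Measure (X A)) (ϕ : ℕ → ℝ) : Prop :=
  (∀ ℓ, 0 < ϕ ℓ) ∧ Antitone ϕ ∧ Tendsto ϕ atTop (nhds 0) ∧
  ∀ n ℓ : ℕ, 1 ≤ n → 1 ≤ ℓ →
    ∀ S T : Set (X A),
      MeasurableSet[MeasurableSpace.comap
        (fun x : X A => fun i : Fin n => x i.val) inferInstance] S →
      MeasurableSet[MeasurableSpace.comap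
        (fun x : X A => fun j : ℕ => x (n + ℓ - 1 + j)) inferInstance] T →
      μ S ≠ 0 →
      |(μ (S ∩ T)).toReal / (μ S).toReal - (μ T).toReal| ≤ ϕ ℓ

section Helpers

variable {A}

/-- The first `n` symbols of a sequence. -/
def restr (n : ℕ) (x : X A) : Fin n → A := fun i => x i

/-- The sequence starting with the word `u` and continuing with `v`. -/
def join {n : ℕ} (u : Fin n → A) (v : X A) : X A :=
  fun i => if h : i < n then u ⟨i, h⟩ else v (i - n)

/-- The entropy of the distribution of the first `n` symbols. -/
noncomputable def blockEntropy (μ : Measure (X A)) (n : ℕ) : ℝ :=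
  -∑ w : Fin n → A, μ.real (cyl A w) * Real.log (μ.real (cyl A w))

omit [Fintype A] [TopologicalSpace A] [DiscreteTopology A] [MeasurableSpace A] [BorelSpace A] in
lemma cyl_eq_preimage {n : ℕ} (w : Fin n → A) : cyl A w = restr n ⁻¹' {w} := by
  ext x
  simp [cyl, restr, funext_iff]

omit [Fintype A] [TopologicalSpace A] [DiscreteTopology A] [BorelSpace A] in
lemma measurable_restr (n : ℕ) : Measurable (restr n : X A → Fin n → A) :=
  measurable_pi_lambda _ fun _ => measurable_pi_apply _

lemma measurableSet_cyl {n : ℕ} (w : Fin n → A) : MeasurableSet (cyl A w) := by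
  rw [cyl_eq_preimage]
  exact measurable_restr n (measurableSet_singleton w)

omit [Fintype A] [TopologicalSpace A] [DiscreteTopology A] [MeasurableSpace A] [BorelSpace A] in
lemma eq_comp_restr {β : Type*} {N : ℕ} {G : X A → β} (hG : DependsOn G (Iio N)) (z : X A) :
    G = (fun w : Fin N → A => G (join w z)) ∘ restr N := by
  funext x
  refine hG fun i hi => ?_
  simp [join, restr, mem_Iio.1 hi]

lemma integrable_of_dependsOn (μ : Measure (X A)) [IsProbabilityMeasure μ] {N : ℕ} {G : X A → ℝ}
    (hG : DependsOn G (Iio N)) : Integrable G μ := by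
  obtain ⟨z⟩ : Nonempty (X A) := μ.nonempty_of_neZero
  rw [eq_comp_restr hG z]
  have : IsProbabilityMeasure (μ.map (restr N)) :=
    Measure.isProbabilityMeasure_map (measurable_restr N).aemeasurable
  exact Integrable.comp_measurable Integrable.of_finite (measurable_restr N)

lemma integral_of_dependsOn (μ : Measure (X A)) [IsProbabilityMeasure μ] {N : ℕ} {G : X A → ℝ}
    (hG : DependsOn G (Iio N)) (z : X A) :
    ∫ x, G x ∂μ = ∑ w : Fin N → A, μ.real (cyl A w) * G (join w z) := by
  have : IsProbabilityMeasure (μ.map (restr N)) :=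
    Measure.isProbabilityMeasure_map (measurable_restr N).aemeasurable
  conv_lhs => rw [eq_comp_restr hG z]
  simp only [Function.comp_def]
  rw [← integral_map (f := fun w : Fin N → A => G (join w z)) (measurable_restr N).aemeasurable
    (measurable_of_finite _).aestronglyMeasurable, integral_fintype Integrable.of_finite]
  refine Finset.sum_congr rfl fun w _ => ?_
  rw [map_measureReal_apply (measurable_restr N) (measurableSet_singleton w), cyl_eq_preimage,
    smul_eq_mul]

lemma sum_measureReal_cyl (μ : Measure (X A)) [IsProbabilityMeasure μ] (N : ℕ) :
    ∑ w : Fin N → A, μ.real (cyl A w) = 1 := by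
  obtain ⟨z⟩ : Nonempty (X A) := μ.nonempty_of_neZero
  have := integral_of_dependsOn μ (N := N) (G := fun _ => (1 : ℝ)) (fun _ _ _ => rfl) z
  simpa using this.symm

omit [Fintype A] [TopologicalSpace A] [DiscreteTopology A] [MeasurableSpace A] [BorelSpace A] in
lemma restr_join {n : ℕ} (u : Fin n → A) (v : X A) : restr n (join u v) = u := by
  funext i
  simp [join, restr]

omit [Fintype A] [TopologicalSpace A] [DiscreteTopology A] [MeasurableSpace A] [BorelSpace A] in
lemma dependsOn_comp_restr {β : Type*} {n N : ℕ} (hnN : n ≤ N) (φ : (Fin n → A) → β) :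
    DependsOn (fun x : X A => φ (restr n x)) (Iio N) := by
  intro x y hxy
  have : restr n x = restr n y := funext fun i => hxy i (mem_Iio.2 (i.2.trans_le hnN))
  simp only [this]

lemma integral_log_cyl (μ : Measure (X A)) [IsProbabilityMeasure μ] (n : ℕ) :
    ∫ x, Real.log (μ.real (cyl A (restr n x))) ∂μ = -blockEntropy μ n := by
  obtain ⟨z⟩ : Nonempty (X A) := μ.nonempty_of_neZero
  rw [integral_of_dependsOn μ
    (dependsOn_comp_restr le_rfl fun w : Fin n → A => Real.log (μ.real (cyl A w))) z]
  simp [restr_join, blockEntropy]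

omit [TopologicalSpace A] [DiscreteTopology A] [BorelSpace A] in
lemma blockEntropy_nonneg (μ : Measure (X A)) [IsProbabilityMeasure μ] (n : ℕ) :
    0 ≤ blockEntropy μ n := by
  rw [blockEntropy, neg_nonneg]
  exact Finset.sum_nonpos fun w _ => mul_nonpos_of_nonneg_of_nonpos measureReal_nonneg
    (Real.log_nonpos measureReal_nonneg measureReal_le_one)

omit [TopologicalSpace A] [DiscreteTopology A] [BorelSpace A] in
lemma entSeq_eq (μ : Measure (X A)) (n : ℕ) : entSeq A μ n = blockEntropy μ n / n := by
  simp only [entSeq, blockEntropy, Measure.real]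
  ring

/-- Gibbs' inequality for a code-length function satisfying Kraft's inequality. -/
lemma blockEntropy_le_integral (μ : Measure (X A)) [IsProbabilityMeasure μ] {N : ℕ} {G : X A → ℝ}
    (hG : DependsOn G (Iio N)) (z : X A)
    (hkraft : ∑ w : Fin N → A, Real.exp (-G (join w z)) ≤ 1) :
    blockEntropy μ N ≤ ∫ x, G x ∂μ := by
  rw [integral_of_dependsOn μ hG z, blockEntropy, ← Finset.sum_neg_distrib]
  have key : ∀ w : Fin N → A, -(μ.real (cyl A w) * Real.log (μ.real (cyl A w))) ≤
      μ.real (cyl A w) * G (join w z) + (Real.exp (-G (join w z)) - μ.real (cyl A w)) := by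
    intro w
    have hp0 : 0 ≤ μ.real (cyl A w) := measureReal_nonneg
    generalize μ.real (cyl A w) = p at hp0 ⊢
    generalize G (join w z) = g
    rcases hp0.eq_or_lt with rfl | hp
    · simpa using (Real.exp_pos (-g)).le
    · have h1 := Real.log_le_sub_one_of_pos (div_pos (Real.exp_pos (-g)) hp)
      rw [Real.log_div (Real.exp_pos _).ne' hp.ne', Real.log_exp] at h1
      have h2 := mul_le_mul_of_nonneg_left h1 hp.le
      have h3 : p * (Real.exp (-g) / p - 1) = Real.exp (-g) - p := by field_simp
      rw [h3] at h2
      linarith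
  have hsum := Finset.sum_le_sum fun w (_ : w ∈ Finset.univ) => key w
  rw [Finset.sum_add_distrib, Finset.sum_sub_distrib, sum_measureReal_cyl] at hsum
  linarith

omit [TopologicalSpace A] [DiscreteTopology A] [MeasurableSpace A] [BorelSpace A] in
lemma sum_join_add {n N N' : ℕ} (hN : N' = n + N) (F : X A → ℝ) (z : X A) :
    ∑ w : Fin N' → A, F (join w z) =
      ∑ v : Fin N → A, ∑ u : Fin n → A, F (join u (join v z)) := by
  subst hN
  rw [← (Fin.appendEquiv n N).sum_comp, Fintype.sum_prod_type_right]
  refine Finset.sum_congr rfl fun v _ => Finset.sum_congr rfl fun u _ => congrArg F ?_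
  funext i
  simp only [join, Fin.appendEquiv, Equiv.coe_fn_mk]
  by_cases h1 : i < n
  · have h2 : i < n + N := by omega
    simp only [h1, h2, dite_true]
    exact Fin.append_left u v ⟨i, h1⟩
  · by_cases h2 : i < n + N
    · have h3 : i - n < N := by omega
      simp only [h1, h2, h3, dite_true, dite_false]
      have h4 : (⟨i, h2⟩ : Fin (n + N)) = Fin.natAdd n ⟨i - n, h3⟩ := by
        ext
        simp
        omega
      rw [h4]
      exact Fin.append_right u v ⟨i - n, h3⟩
    · have h3 : ¬ i - n < N := by omega
      simp only [h1, h2, h3, dite_false]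
      congr 1
      omega

omit [Fintype A] [TopologicalSpace A] [DiscreteTopology A] [BorelSpace A] in
lemma measurePreserving_shift_iterate {μ : Measure (X A)} (hμ : MeasurePreserving (shift A) μ μ)
    (n : ℕ) : MeasurePreserving (fun (x : X A) i => x (i + n)) μ μ := by
  have h1 : ∀ n, (shift A)^[n] = fun (x : X A) i => x (i + n) := by
    intro n
    induction n with
    | zero => rfl
    | succ n ih =>
      rw [Function.iterate_succ', ih]
      funext x i
      simp only [Function.comp_apply, shift]
      congr 1
      omega
  rw [← h1]
  exact hμ.iterate n

/-- Concatenating `j` conditional codes for `n`-blocks with a trivial code for the last `M`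
symbols bounds the entropy of blocks of length `j * n + M`. -/
lemma blockEntropy_mul_add_le [Nonempty A] {μ : Measure (X A)} [IsProbabilityMeasure μ]
    (hμ : MeasurePreserving (shift A) μ μ) {n M : ℕ} {L : X A → ℝ}
    (hL : DependsOn L (Iio (n + M)))
    (hkraft : ∀ v : X A, ∑ u : Fin n → A, Real.exp (-L (join u v)) ≤ 1) (j : ℕ) :
    blockEntropy μ (j * n + M) ≤ j * ∫ x, L x ∂μ + M * Real.log (Fintype.card A) := by
  have key : ∀ j : ℕ, ∃ G : X A → ℝ, DependsOn G (Iio (j * n + M)) ∧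
      (∀ z, ∑ w : Fin (j * n + M) → A, Real.exp (-G (join w z)) ≤ 1) ∧
      ∫ x, G x ∂μ = j * ∫ x, L x ∂μ + M * Real.log (Fintype.card A) := by
    intro j
    induction j with
    | zero =>
      refine ⟨fun _ => M * Real.log (Fintype.card A), fun _ _ _ => rfl, fun z => ?_, by simp⟩
      have hc : (0 : ℝ) < Fintype.card A := by exact_mod_cast Fintype.card_pos
      simp [Real.exp_neg, mul_comm (M : ℝ), Real.exp_mul, Real.exp_log hc, hc.ne']
    | succ j ih =>
      obtain ⟨G, hG, hGk, hGi⟩ := ih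
      have hN : (j + 1) * n + M = n + (j * n + M) := by ring
      have hG' : DependsOn (fun x : X A => G fun i => x (i + n)) (Iio ((j + 1) * n + M)) := by
        intro x y hxy
        refine hG fun i hi => hxy _ ?_
        simp only [mem_Iio] at hi ⊢
        omega
      have hL' : DependsOn L (Iio ((j + 1) * n + M)) := by
        refine fun x y hxy => hL fun i hi => hxy i ?_
        simp only [mem_Iio] at hi ⊢
        have : 0 ≤ j * n := Nat.zero_le _
        omega
      refine ⟨fun x => L x + G fun i => x (i + n), ?_, fun z => ?_, ?_⟩
      · intro x y hxy
        simp only [hL' hxy]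
        congr 1
        exact hG' hxy
      · rw [sum_join_add hN (fun x => Real.exp (-(L x + G fun i => x (i + n)))) z]
        refine le_trans (Finset.sum_le_sum fun v _ => ?_) (hGk z)
        have hshift : ∀ u : Fin n → A, (fun i => join u (join v z) (i + n)) = join v z := by
          intro u
          funext i
          simp [join]
        simp only [hshift, neg_add, Real.exp_add, ← Finset.sum_mul]
        exact mul_le_of_le_one_left (Real.exp_pos _).le (hkraft _)
      · rw [integral_add (integrable_of_dependsOn μ hL') (integrable_of_dependsOn μ hG')]
        have hmp := measurePreserving_shift_iterate hμ n
        have hcomp : ∫ x, G (fun i => x (i + n)) ∂μ = ∫ x, G x ∂μ := by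
          conv_rhs => rw [← hmp.map_eq]
          rw [integral_map hmp.measurable.aemeasurable]
          rw [hmp.map_eq]
          exact (integrable_of_dependsOn μ hG).aestronglyMeasurable
        rw [hcomp, hGi]
        push_cast
        ring
  obtain ⟨G, hG, hGk, hGi⟩ := key j
  obtain ⟨z⟩ : Nonempty (X A) := inferInstance
  rw [← hGi]
  exact blockEntropy_le_integral μ hG z (hGk z)

lemma mul_entropy_le_integral [Nonempty A] {μ : Measure (X A)} [IsProbabilityMeasure μ]
    (hμ : MeasurePreserving (shift A) μ μ) {h : ℝ} (hent : Tendsto (entSeq A μ) atTop (𝓝 h))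
    {n M : ℕ} (hn : 0 < n) {L : X A → ℝ} (hL : DependsOn L (Iio (n + M)))
    (hkraft : ∀ v : X A, ∑ u : Fin n → A, Real.exp (-L (join u v)) ≤ 1) :
    n * h ≤ ∫ x, L x ∂μ := by
  have hj : Tendsto (fun j : ℕ => j * n + M) atTop atTop :=
    tendsto_atTop_mono (fun j => by nlinarith : ∀ j : ℕ, j ≤ j * n + M) tendsto_id
  have h1 : Tendsto (fun j : ℕ => ((n : ℝ) + M / j) * entSeq A μ (j * n + M)) atTop
      (𝓝 (((n : ℝ) + 0) * h)) :=
    (tendsto_const_nhds.add (tendsto_const_div_atTop_nhds_zero_nat _)).mul (hent.comp hj)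
  have h2 : Tendsto (fun j : ℕ => ∫ x, L x ∂μ + (M * Real.log (Fintype.card A)) / j) atTop
      (𝓝 (∫ x, L x ∂μ + 0)) :=
    tendsto_const_nhds.add (tendsto_const_div_atTop_nhds_zero_nat _)
  rw [add_zero] at h1 h2
  refine le_of_tendsto_of_tendsto h1 h2 ?_
  filter_upwards [eventually_gt_atTop 0] with j hj0
  have hjr : (0 : ℝ) < j := by exact_mod_cast hj0
  have hnr : (0 : ℝ) < n := by exact_mod_cast hn
  have hb := blockEntropy_mul_add_le hμ hL hkraft j
  rw [entSeq_eq]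
  have hM : (0 : ℝ) ≤ M := Nat.cast_nonneg M
  have e1 : ((n : ℝ) + M / j) * (blockEntropy μ (j * n + M) / ((j * n + M : ℕ) : ℝ)) =
      blockEntropy μ (j * n + M) / j := by
    have : (j : ℝ) * n + M ≠ 0 := by positivity
    push_cast
    field_simp
  rw [e1, div_le_iff₀ hjr, add_mul, div_mul_cancel₀ _ hjr.ne']
  linarith

/-- The first `n` symbols of `x` do not reappear at any of the positions `1, …, k`. -/
def NoReturn (n k : ℕ) (x : X A) : Prop :=
  ∀ j, 1 ≤ j → j ≤ k → ¬ ∀ i < n, x (j + i) = x i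

/-- The first position at least `1` where the first `n` symbols of `x` reappear, truncated
at `M`. -/
noncomputable def truncReturn (n M : ℕ) (x : X A) : ℕ :=
  sInf {k | 1 ≤ k ∧ (M ≤ k ∨ ∀ i < n, x (k + i) = x i)}

omit [Fintype A] [TopologicalSpace A] [DiscreteTopology A] [MeasurableSpace A] [BorelSpace A] in
lemma truncReturn_mem {n M : ℕ} (hM : 1 ≤ M) (x : X A) :
    1 ≤ truncReturn n M x ∧
      (M ≤ truncReturn n M x ∨ ∀ i < n, x (truncReturn n M x + i) = x i) :=
  Nat.sInf_mem (s := {k | 1 ≤ k ∧ (M ≤ k ∨ ∀ i < n, x (k + i) = x i)}) ⟨M, hM, Or.inl le_rfl⟩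

omit [Fintype A] [TopologicalSpace A] [DiscreteTopology A] [MeasurableSpace A] [BorelSpace A] in
lemma truncReturn_le {n M : ℕ} (hM : 1 ≤ M) (x : X A) : truncReturn n M x ≤ M :=
  Nat.sInf_le ⟨hM, Or.inl le_rfl⟩

omit [Fintype A] [TopologicalSpace A] [DiscreteTopology A] [MeasurableSpace A] [BorelSpace A] in
lemma noReturn_of_lt_truncReturn {n M k : ℕ} {x : X A} (hk : k < truncReturn n M x) :
    NoReturn n k x := by
  intro j hj hjk hret
  have := Nat.sInf_le (s := {k | 1 ≤ k ∧ (M ≤ k ∨ ∀ i < n, x (k + i) = x i)}) ⟨hj, Or.inr hret⟩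
  exact absurd (hk.trans_le (this.trans hjk)) (lt_irrefl _)

omit [Fintype A] [TopologicalSpace A] [DiscreteTopology A] [MeasurableSpace A] [BorelSpace A] in
lemma returns_truncReturn {n M : ℕ} (hM : 1 ≤ M) {x : X A} (hx : ¬ NoReturn n M x) :
    ∀ i < n, x (truncReturn n M x + i) = x i := by
  rcases (truncReturn_mem (n := n) hM x).2 with hle | hret
  · unfold NoReturn at hx
    push Not at hx
    obtain ⟨j, hj1, hjM, hret⟩ := hx
    have hjle : truncReturn n M x ≤ j := Nat.sInf_le ⟨hj1, Or.inr hret⟩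
    have : truncReturn n M x = j := le_antisymm hjle (hjM.trans hle)
    rw [this]
    exact hret
  · exact hret

omit [Fintype A] [TopologicalSpace A] [DiscreteTopology A] [MeasurableSpace A] [BorelSpace A] in
lemma dependsOn_noReturn (n k : ℕ) : DependsOn (NoReturn (A := A) n k) (Iio (n + k)) := by
  intro x y hxy
  have key : ∀ j, j ≤ k → ((∀ i < n, x (j + i) = x i) ↔ ∀ i < n, y (j + i) = y i) := by
    intro j hj
    refine forall₂_congr fun i hi => ?_
    rw [hxy (j + i) (mem_Iio.2 (by omega)), hxy i (mem_Iio.2 (by omega))]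
  exact propext (forall₃_congr fun j _ hj => not_congr (key j hj))

omit [Fintype A] [TopologicalSpace A] [DiscreteTopology A] [MeasurableSpace A] [BorelSpace A] in
lemma dependsOn_truncReturn {n M : ℕ} :
    DependsOn (truncReturn (A := A) n M) (Iio (n + M)) := by
  intro x y hxy
  rw [truncReturn, truncReturn]
  congr 1
  ext k
  simp only [mem_ofPred_eq]
  refine and_congr_right fun _ => ?_
  by_cases hMk : M ≤ k
  · simp [hMk]
  · refine or_congr_right (forall₂_congr fun i hi => ?_)
    rw [hxy (k + i) (mem_Iio.2 (by omega)), hxy i (mem_Iio.2 (by omega))]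

omit [Fintype A] [TopologicalSpace A] [DiscreteTopology A] [MeasurableSpace A] [BorelSpace A] in
/-- A word is determined by its continuation and any of its return times. -/
lemma join_left_injective_of_returns {n k : ℕ} (hk : 1 ≤ k) {u u' : Fin n → A} {v : X A}
    (hu : ∀ i < n, join u v (k + i) = join u v i)
    (hu' : ∀ i < n, join u' v (k + i) = join u' v i) : u = u' := by
  have key : ∀ d i, n ≤ i + d → join u v i = join u' v i := by
    intro d
    induction d with
    | zero =>
      intro i hi
      have : ¬ i < n := by omega
      simp [join, this]
    | succ d ih =>
      intro i hi
      by_cases hin : i < n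
      · rw [← hu i hin, ← hu' i hin]
        exact ih _ (by omega)
      · simp [join, hin]
  funext i
  have := key n i (by omega)
  simpa [join] using this

open Classical in
/-- The length of the code describing the first `n` symbols of `x` by their return time when
it is at most `M`, and symbol by symbol otherwise. -/
noncomputable def returnCode (n M : ℕ) (x : X A) : ℝ :=
  Real.log (2 + Real.log M) +
    if NoReturn n M x then n * Real.log (Fintype.card A) else Real.log (truncReturn n M x)

omit [TopologicalSpace A] [DiscreteTopology A] [MeasurableSpace A] [BorelSpace A] in
lemma dependsOn_returnCode {n M : ℕ} :
    DependsOn (returnCode (A := A) n M) (Iio (n + M)) := by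
  intro x y hxy
  have hiff := iff_of_eq (dependsOn_noReturn n M hxy)
  by_cases hy : NoReturn n M y <;>
    simp [returnCode, hiff, hy, dependsOn_truncReturn hxy]

omit [TopologicalSpace A] [DiscreteTopology A] [MeasurableSpace A] [BorelSpace A] in
lemma sum_exp_neg_returnCode_le [Nonempty A] {n M : ℕ} (hM : 1 ≤ M) (v : X A) :
    ∑ u : Fin n → A, Real.exp (-returnCode n M (join u v)) ≤ 1 := by
  classical
  have hlogM : 0 ≤ Real.log M := Real.log_natCast_nonneg M
  set c : ℝ := 2 + Real.log M with hc
  have hc0 : 0 < c := by positivity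
  have hcard : (0 : ℝ) < Fintype.card A := by exact_mod_cast Fintype.card_pos
  set r : (Fin n → A) → ℕ := fun u => truncReturn n M (join u v) with hr
  have hr1 : ∀ u, 1 ≤ r u := fun u => (truncReturn_mem hM _).1
  have hterm : ∀ u : Fin n → A, Real.exp (-returnCode n M (join u v)) ≤
      c⁻¹ * (((Fintype.card A : ℝ) ^ n)⁻¹ +
        if NoReturn n M (join u v) then 0 else ((r u : ℕ) : ℝ)⁻¹) := by
    intro u
    rw [returnCode, neg_add, Real.exp_add, Real.exp_neg, Real.exp_log hc0]
    refine mul_le_mul_of_nonneg_left ?_ (inv_nonneg.2 hc0.le)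
    split_ifs
    · rw [Real.exp_neg, mul_comm, Real.exp_mul, Real.exp_log hcard, Real.rpow_natCast, add_zero]
    · have : (0 : ℝ) < r u := by exact_mod_cast hr1 u
      rw [Real.exp_neg, Real.exp_log this]
      exact le_add_of_nonneg_left (by positivity)
  refine (Finset.sum_le_sum fun u _ => hterm u).trans ?_
  rw [← Finset.mul_sum, Finset.sum_add_distrib]
  have h1 : ∑ _u : Fin n → A, ((Fintype.card A : ℝ) ^ n)⁻¹ = 1 := by
    simp [hcard.ne']
  have h2 : ∑ u : Fin n → A, (if NoReturn n M (join u v) then 0 else ((r u : ℕ) : ℝ)⁻¹) ≤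
      1 + Real.log M := by
    have e1 : ∑ u : Fin n → A, (if NoReturn n M (join u v) then 0 else ((r u : ℕ) : ℝ)⁻¹) =
        ∑ u with ¬ NoReturn n M (join u v), ((r u : ℕ) : ℝ)⁻¹ := by
      rw [Finset.sum_filter]
      refine Finset.sum_congr rfl fun u _ => ?_
      split_ifs <;> simp_all
    have hinj : Set.InjOn r {u | ¬ NoReturn n M (join u v)} := by
      intro u hu u' hu' huu'
      have hu := returns_truncReturn hM hu
      have hu' := returns_truncReturn hM hu'
      have huu' : truncReturn n M (join u v) = truncReturn n M (join u' v) := huu'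
      rw [← huu'] at hu'
      exact join_left_injective_of_returns (hr1 u) hu hu'
    rw [e1, ← Finset.sum_image (f := fun k : ℕ => (k : ℝ)⁻¹) (by simpa using hinj)]
    refine le_trans (Finset.sum_le_sum_of_subset_of_nonneg (t := Finset.Icc 1 M) ?_ ?_) ?_
    · intro k hk
      obtain ⟨u, -, rfl⟩ := Finset.mem_image.1 hk
      exact Finset.mem_Icc.2 ⟨hr1 u, truncReturn_le hM _⟩
    · intros
      positivity
    · have := harmonic_le_one_add_log M
      rw [harmonic_eq_sum_Icc] at this
      push_cast at this
      exact this
  rw [h1, inv_mul_le_iff₀ hc0]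
  linarith

/-- The word `w` occurs in `y` at position `k`. -/
def Occurs {n : ℕ} (w : Fin n → A) (k : ℕ) (y : X A) : Prop := ∀ i : Fin n, y (k + i) = w i

lemma measurableSet_occurs {n : ℕ} (w : Fin n → A) (k : ℕ) :
    MeasurableSet {y : X A | Occurs w k y} := by
  simp only [Occurs, ofPred_forall]
  exact MeasurableSet.iInter fun i =>
    measurableSet_eq_fun (measurable_pi_apply (k + i.val)) measurable_const

lemma measurableSet_avoid {n : ℕ} (w : Fin n → A) (k : ℕ) :
    MeasurableSet {y : X A | ∀ j < k, ¬ Occurs w j y} := by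
  simp only [ofPred_forall]
  exact MeasurableSet.iInter fun j => MeasurableSet.iInter fun _ =>
    (measurableSet_occurs w j).compl

/-- The set of sequences in which the first occurrence of `w` is at position `k`. -/
def firstOccurrence {n : ℕ} (w : Fin n → A) (k : ℕ) : Set (X A) :=
  {y | (∀ j < k, ¬ Occurs w j y) ∧ Occurs w k y}

lemma measurableSet_firstOccurrence {n : ℕ} (w : Fin n → A) (k : ℕ) :
    MeasurableSet (firstOccurrence w k) :=
  (measurableSet_avoid w k).inter (measurableSet_occurs w k)

omit [Fintype A] [TopologicalSpace A] [DiscreteTopology A] [MeasurableSpace A] [BorelSpace A] in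
lemma pairwise_disjoint_firstOccurrence {n : ℕ} (w : Fin n → A) :
    Pairwise (Function.onFun Disjoint (firstOccurrence w)) := by
  intro j k hjk
  refine Set.disjoint_left.2 fun y hj hk => ?_
  rcases lt_or_gt_of_ne hjk with hlt | hlt
  · exact hk.1 j hlt hj.2
  · exact hj.1 k hlt hk.2

lemma measureReal_cyl_inter_noReturn {μ : Measure (X A)} [IsProbabilityMeasure μ]
    (hμ : MeasurePreserving (shift A) μ μ) {n : ℕ} (w : Fin n → A) (k : ℕ) :
    μ.real (cyl A w ∩ {x | NoReturn n k x}) = μ.real (firstOccurrence w k) := by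
  have hocc : ∀ (j : ℕ) (y : X A), Occurs w j (shift A y) ↔ Occurs w (j + 1) y := by
    intro j y
    refine forall_congr' fun i => ?_
    rw [shift, add_right_comm]
  have e1 : firstOccurrence w k =
      {y : X A | ∀ j < k, ¬ Occurs w j y} \ {y | ∀ j < k + 1, ¬ Occurs w j y} := by
    ext y
    simp only [firstOccurrence, Set.mem_sdiff, mem_ofPred_eq]
    refine and_congr_right fun hav => ⟨fun ho hn => hn k k.lt_succ_self ho, fun hn => ?_⟩
    by_contra ho
    refine hn fun j hj => ?_
    rcases Nat.lt_succ_iff_lt_or_eq.1 hj with hlt | rfl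
    · exact hav j hlt
    · exact ho
  have e2 : cyl A w ∩ {x | NoReturn n k x} =
      shift A ⁻¹' {y : X A | ∀ j < k, ¬ Occurs w j y} \ {y | ∀ j < k + 1, ¬ Occurs w j y} := by
    ext y
    simp only [Set.mem_sdiff, mem_preimage, mem_ofPred_eq, mem_inter_iff, hocc]
    have hret : y ∈ cyl A w → ∀ j, (∀ i < n, y (j + i) = y i) ↔ Occurs w j y := by
      intro hy j
      constructor
      · intro hj i
        rw [hj i i.2]
        exact hy i
      · intro hj i hi
        rw [hj ⟨i, hi⟩]
        exact (hy ⟨i, hi⟩).symm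
    have hcyl : y ∈ cyl A w ↔ Occurs w 0 y := by
      simp [cyl, Occurs]
    constructor
    · rintro ⟨hy, hn⟩
      refine ⟨fun j hj ho => hn (j + 1) (by omega) (by omega) ((hret hy _).2 ho), fun hav => ?_⟩
      exact hav 0 k.succ_pos (hcyl.1 hy)
    · rintro ⟨hav, hn⟩
      have hy : y ∈ cyl A w := by
        rw [hcyl]
        by_contra h0
        refine hn fun j hj => ?_
        rcases j with _ | j
        · exact h0
        · exact hav j (by omega)
      refine ⟨hy, fun j hj1 hjk hj => ?_⟩
      obtain ⟨j, rfl⟩ := Nat.exists_eq_add_of_le' hj1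
      exact hav j (by omega) ((hret hy _).1 hj)
  rw [e1, e2, measureReal_sdiff _ (measurableSet_avoid w (k + 1)),
    measureReal_sdiff _ (measurableSet_avoid w (k + 1)),
    hμ.measureReal_preimage (measurableSet_avoid w k).nullMeasurableSet]
  · exact fun y hy j hj => hy j (hj.trans k.lt_succ_self)
  · exact fun y hy j hj => by
      rw [hocc]
      exact hy (j + 1) (by omega)

lemma mul_measureReal_cyl_inter_noReturn_le {μ : Measure (X A)} [IsProbabilityMeasure μ]
    (hμ : MeasurePreserving (shift A) μ μ) {n : ℕ} (w : Fin n → A) (M : ℕ) :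
    M * μ.real (cyl A w ∩ {x | NoReturn n M x}) ≤ 1 := by
  have h1 : ∀ k ∈ Finset.range M, μ.real (cyl A w ∩ {x | NoReturn n M x}) ≤
      μ.real (firstOccurrence w k) := by
    intro k hk
    rw [← measureReal_cyl_inter_noReturn hμ]
    refine measureReal_mono (inter_subset_inter_right _ fun x hx j hj hjk => hx j hj ?_)
    exact hjk.trans (Finset.mem_range.1 hk).le
  have h2 := Finset.sum_le_sum h1
  rw [Finset.sum_const, Finset.card_range, nsmul_eq_mul] at h2
  refine h2.trans ?_
  rw [← measureReal_biUnion_finset (fun j _ k _ hjk => pairwise_disjoint_firstOccurrence w hjk)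
    fun k _ => measurableSet_firstOccurrence w k]
  exact measureReal_le_one

lemma measurableSet_noReturn (n k : ℕ) : MeasurableSet {x : X A | NoReturn n k x} := by
  obtain hA | ⟨⟨z⟩⟩ := isEmpty_or_nonempty (X A)
  · exact (Set.eq_empty_of_isEmpty {x : X A | NoReturn n k x}) ▸ MeasurableSet.empty
  · have : {x : X A | NoReturn n k x} =
        restr (n + k) ⁻¹' {w : Fin (n + k) → A | NoReturn n k (join w z)} := by
      ext x
      exact iff_of_eq (congrFun (eq_comp_restr (dependsOn_noReturn n k) z) x)
    rw [this]
    exact measurable_restr _ (Set.toFinite _).measurableSet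

lemma integral_mul_indicator_eq_sum (μ : Measure (X A)) [IsProbabilityMeasure μ] {n : ℕ}
    (φ : (Fin n → A) → ℝ) {S : Set (X A)} (hS : MeasurableSet S) :
    ∫ x, φ (restr n x) * S.indicator 1 x ∂μ = ∑ w, φ w * μ.real (cyl A w ∩ S) := by
  classical
  have h1 : ∀ x, φ (restr n x) * S.indicator 1 x =
      ∑ w, φ w * (cyl A w ∩ S).indicator (1 : X A → ℝ) x := by
    intro x
    rw [Finset.sum_eq_single (restr n x)]
    · have : x ∈ cyl A (restr n x) := fun i => rfl
      simp [Set.indicator, this]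
    · intro w _ hw
      have : x ∉ cyl A w := by
        rw [cyl_eq_preimage]
        exact fun hx => hw hx.symm
      simp [this]
    · simp
  simp only [h1]
  rw [integral_finsetSum]
  · refine Finset.sum_congr rfl fun w _ => ?_
    rw [integral_const_mul, integral_indicator_one ((measurableSet_cyl w).inter hS)]
  · intro w _
    refine Integrable.const_mul ?_ _
    exact (integrable_const (1 : ℝ)).indicator ((measurableSet_cyl w).inter hS)

lemma mul_measureReal_noReturn_le {μ : Measure (X A)} [IsProbabilityMeasure μ]
    (hμ : MeasurePreserving (shift A) μ μ) (n M : ℕ) :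
    M * μ.real {x : X A | NoReturn n M x} ≤ (Fintype.card A : ℝ) ^ n := by
  have h1 := integral_mul_indicator_eq_sum μ (fun _ : Fin n → A => 1)
    (measurableSet_noReturn n M)
  simp only [one_mul] at h1
  rw [integral_indicator_one (measurableSet_noReturn n M)] at h1
  rw [h1, Finset.mul_sum]
  refine (Finset.sum_le_sum fun w _ => mul_measureReal_cyl_inter_noReturn_le hμ w M).trans ?_
  simp

/-- The expected logarithm of the return time is at least the entropy up to lower order terms. -/
lemma mul_entropy_le_integral_log_truncReturn [Nonempty A] {μ : Measure (X A)}
    [IsProbabilityMeasure μ] (hμ : MeasurePreserving (shift A) μ μ) {h : ℝ}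
    (hent : Tendsto (entSeq A μ) atTop (𝓝 h)) {n M : ℕ} (hn : 0 < n) (hM : 1 ≤ M) :
    n * h ≤ Real.log (2 + Real.log M) +
      n * Real.log (Fintype.card A) * ((Fintype.card A : ℝ) ^ n / M) +
      ∫ x, Real.log (truncReturn n M x) ∂μ := by
  classical
  have hMr : (0 : ℝ) < M := by exact_mod_cast hM
  refine (mul_entropy_le_integral hμ hent hn dependsOn_returnCode
    (sum_exp_neg_returnCode_le hM)).trans ?_
  have hdep : DependsOn (fun x : X A => Real.log (truncReturn n M x)) (Iio (n + M)) := by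
    intro x y hxy
    simp only [dependsOn_truncReturn hxy]
  have hint := integrable_of_dependsOn μ hdep
  have hlog : 0 ≤ Real.log (Fintype.card A) := Real.log_natCast_nonneg _
  have hind : Integrable (fun x : X A => n * Real.log (Fintype.card A) *
      {x : X A | NoReturn n M x}.indicator 1 x) μ :=
    ((integrable_const (1 : ℝ)).indicator (measurableSet_noReturn n M)).const_mul _
  have hle : ∀ x : X A, returnCode n M x ≤ Real.log (2 + Real.log M) +
      n * Real.log (Fintype.card A) * {x : X A | NoReturn n M x}.indicator 1 x +
      Real.log (truncReturn n M x) := by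
    intro x
    have h0 : 0 ≤ Real.log (truncReturn n M x) := Real.log_natCast_nonneg _
    by_cases hx : NoReturn n M x
    · simp [returnCode, hx, h0]
    · simp [returnCode, hx]
  refine (integral_mono (integrable_of_dependsOn μ dependsOn_returnCode)
    (((integrable_const _).add hind).add hint) hle).trans ?_
  rw [integral_add' ((integrable_const _).add hind) hint, integral_add' (integrable_const _) hind,
    integral_const_mul, integral_indicator_one (measurableSet_noReturn n M)]
  simp only [integral_const, probReal_univ, one_smul]
  have h3 : μ.real {x : X A | NoReturn n M x} ≤ (Fintype.card A : ℝ) ^ n / M := by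
    rw [le_div_iff₀ hMr, mul_comm]
    exact mul_measureReal_noReturn_le hμ n M
  gcongr

omit [Fintype A] [TopologicalSpace A] [DiscreteTopology A] [MeasurableSpace A] [BorelSpace A] in
lemma hitTime_of_mem_firstOccurrence {n k : ℕ} {w : Fin n → A} {y : X A}
    (hy : y ∈ firstOccurrence w k) : hitTime A w y = k + 1 := by
  refine le_antisymm (Nat.sInf_le ⟨by omega, fun i => hy.2 i⟩) ?_
  refine le_csInf ⟨k + 1, by omega, fun i => hy.2 i⟩ ?_
  rintro j ⟨hj1, hj⟩
  by_contra hlt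
  exact hy.1 (j - 1) (by omega) hj

omit [Fintype A] [TopologicalSpace A] [DiscreteTopology A] [MeasurableSpace A] [BorelSpace A] in
lemma lt_hitTime {n K : ℕ} {w : Fin n → A} {y : X A} (hav : ∀ j < K, ¬ Occurs w j y)
    (hoc : ∃ j, Occurs w j y) : K < hitTime A w y := by
  obtain ⟨j, hj⟩ := hoc
  refine Nat.lt_of_succ_le (le_csInf ⟨j + 1, by omega, fun i => hj i⟩ ?_)
  rintro j ⟨hj1, hj⟩
  by_contra hlt
  exact hav (j - 1) (by omega) hj

lemma exp_integral_log_le {μ : Measure (X A)} [IsProbabilityMeasure μ] {N : ℕ} {f : X A → ℝ}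
    (hf : DependsOn f (Iio N)) (hpos : ∀ᵐ x ∂μ, 0 < f x) :
    Real.exp (∫ x, Real.log (f x) ∂μ) ≤ ∫ x, f x ∂μ := by
  have hae : (fun x => Real.exp (Real.log (f x))) =ᵐ[μ] f := by
    filter_upwards [hpos] with x hx using Real.exp_log hx
  have hlog : DependsOn (fun x => Real.log (f x)) (Iio N) := fun x y hxy => by
    simp only [hf hxy]
  rw [← integral_congr_ae hae]
  exact convexOn_exp.map_integral_le Real.continuous_exp.continuousOn isClosed_univ
    (ae_of_all _ fun _ => mem_univ _) (integrable_of_dependsOn μ hlog)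
    ((integrable_of_dependsOn μ hf).congr hae.symm)

omit [TopologicalSpace A] [DiscreteTopology A] [BorelSpace A] in
lemma ae_measureReal_cyl_pos (μ : Measure (X A)) [IsProbabilityMeasure μ] (n : ℕ) :
    ∀ᵐ x ∂μ, 0 < μ.real (cyl A (restr n x)) := by
  have h1 : ∀ᵐ x ∂μ, ∀ w : Fin n → A, x ∈ cyl A w → 0 < μ.real (cyl A w) := by
    refine ae_all_iff.2 fun w => ?_
    rcases (measureReal_nonneg : 0 ≤ μ.real (cyl A w)).eq_or_lt with h0 | h0
    · have : μ (cyl A w) = 0 := (measureReal_eq_zero_iff).1 h0.symm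
      filter_upwards [measure_eq_zero_iff_ae_notMem.1 this] with x hx hxw using absurd hxw hx
    · exact ae_of_all _ fun _ _ => h0
  filter_upwards [h1] with x hx using hx _ fun _ => rfl

lemma sum_mul_le_lintegral_prod {ι : Type*} (μ : Measure (X A)) [IsProbabilityMeasure μ]
    (S : Finset ι) {s t : ι → Set (X A)} {c : ι → ℝ} {f : X A × X A → ENNReal}
    (hs : ∀ i, MeasurableSet (s i)) (ht : ∀ i, MeasurableSet (t i)) (hc : ∀ i, 0 ≤ c i)
    (hdisj : (S : Set ι).PairwiseDisjoint fun i => s i ×ˢ t i)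
    (hf : ∀ i ∈ S, ∀ p ∈ s i ×ˢ t i, ENNReal.ofReal (c i) ≤ f p) :
    ENNReal.ofReal (∑ i ∈ S, c i * (μ.real (s i) * μ.real (t i))) ≤ ∫⁻ p, f p ∂(μ.prod μ) := by
  refine le_trans ?_ (setLIntegral_le_lintegral (⋃ i ∈ S, s i ×ˢ t i) f)
  rw [lintegral_biUnion_finset hdisj fun i _ => (hs i).prod (ht i),
    ENNReal.ofReal_sum_of_nonneg fun i _ => by have := hc i; positivity]
  refine Finset.sum_le_sum fun i hi => ?_
  refine le_trans (le_of_eq ?_) (setLIntegral_mono' ((hs i).prod (ht i)) (hf i hi))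
  rw [setLIntegral_const, Measure.prod_prod, ENNReal.ofReal_mul (hc i),
    ENNReal.ofReal_mul measureReal_nonneg, ofReal_measureReal, ofReal_measureReal]

omit [Fintype A] [TopologicalSpace A] [DiscreteTopology A] [MeasurableSpace A] [BorelSpace A] in
lemma disjoint_cyl {n : ℕ} {w w' : Fin n → A} (h : w ≠ w') : Disjoint (cyl A w) (cyl A w') := by
  rw [cyl_eq_preimage, cyl_eq_preimage]
  exact (disjoint_singleton.2 h).preimage _

/-- The double integral of the `q`-th power of the hitting time of the first `n` symbols. -/
noncomputable def hitMoment (μ : Measure (X A)) (q : ℝ) (n : ℕ) : ENNReal :=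
  ∫⁻ p : X A × X A, ENNReal.ofReal
    ((hitTime A (fun i : Fin n => p.1 i.val) p.2 : ℝ) ^ q) ∂(μ.prod μ)

lemma sum_firstOccurrence_le_hitMoment (μ : Measure (X A)) [IsProbabilityMeasure μ]
    (q : ℝ) (n M : ℕ) :
    ENNReal.ofReal (∑ k ∈ Finset.range M, ∑ w : Fin n → A,
      ((k + 1 : ℕ) : ℝ) ^ q * (μ.real (cyl A w) * μ.real (firstOccurrence w k))) ≤
      hitMoment μ q n := by
  rw [← Finset.sum_product']
  refine sum_mul_le_lintegral_prod μ (Finset.range M ×ˢ Finset.univ)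
    (s := fun i : ℕ × (Fin n → A) => cyl A i.2) (t := fun i => firstOccurrence i.2 i.1)
    (c := fun i => ((i.1 + 1 : ℕ) : ℝ) ^ q) (fun i => measurableSet_cyl _)
    (fun i => measurableSet_firstOccurrence _ _) (fun i => by positivity) ?_ ?_
  · rintro ⟨k, w⟩ - ⟨k', w'⟩ - hne
    simp only [Function.onFun, Set.disjoint_prod]
    by_cases hw : w = w'
    · subst hw
      refine Or.inr (pairwise_disjoint_firstOccurrence w fun hk => hne ?_)
      rw [hk]
    · exact Or.inl (disjoint_cyl hw)
  · rintro ⟨k, w⟩ - ⟨x, y⟩ ⟨hx, hy⟩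
    have hxw : (fun i : Fin n => x i.val) = w := funext hx
    simp only [hxw]
    rw [hitTime_of_mem_firstOccurrence hy]

lemma rpow_le_sum_range_rpow {q s : ℝ} (hq : q < 0) (hs : s = max (1 + q) 0) {r : ℕ}
    (hr : 1 ≤ r) : (r : ℝ) ^ s ≤ ∑ k ∈ Finset.range r, ((k + 1 : ℕ) : ℝ) ^ q := by
  have hr0 : (0 : ℝ) < r := by exact_mod_cast hr
  rcases le_total (1 + q) 0 with h1 | h1
  · rw [hs, max_eq_right h1, Real.rpow_zero]
    have := Finset.single_le_sum (f := fun k : ℕ => ((k + 1 : ℕ) : ℝ) ^ q)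
      (fun k _ => by positivity) (Finset.mem_range.2 hr)
    simpa using this
  · rw [hs, max_eq_left h1, Real.rpow_add hr0, Real.rpow_one]
    calc (r : ℝ) * (r : ℝ) ^ q = ∑ k ∈ Finset.range r, (r : ℝ) ^ q := by simp
      _ ≤ _ := by
        refine Finset.sum_le_sum fun k hk => ?_
        refine Real.rpow_le_rpow_of_nonpos (by positivity) ?_ hq.le
        exact_mod_cast Finset.mem_range.1 hk

lemma exp_le_hitMoment_of_neg {μ : Measure (X A)} [IsProbabilityMeasure μ]
    (hμ : MeasurePreserving (shift A) μ μ) {q s : ℝ} (hq : q < 0) (hs : s = max (1 + q) 0)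
    (n : ℕ) {M : ℕ} (hM : 1 ≤ M) :
    ENNReal.ofReal (Real.exp (-blockEntropy μ n + s * ∫ x, Real.log (truncReturn n M x) ∂μ)) ≤
      hitMoment μ q n := by
  refine le_trans (ENNReal.ofReal_le_ofReal ?_) (sum_firstOccurrence_le_hitMoment μ q n M)
  set P : X A → ℝ := fun x => μ.real (cyl A (restr n x)) with hP
  have hPdep : DependsOn P (Iio (n + M)) :=
    dependsOn_comp_restr (Nat.le_add_right n M) fun w : Fin n → A => μ.real (cyl A w)
  have hRdep := dependsOn_truncReturn (A := A) (n := n) (M := M)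
  have hr0 : ∀ x : X A, (0 : ℝ) < truncReturn n M x := fun x => by
    exact_mod_cast (truncReturn_mem (n := n) hM x).1
  have hfdep : DependsOn (fun x => P x * (truncReturn n M x : ℝ) ^ s) (Iio (n + M)) :=
    fun x y hxy => by simp only [hPdep hxy, hRdep hxy]
  have hlogR : DependsOn (fun x : X A => Real.log (truncReturn n M x)) (Iio (n + M)) :=
    fun x y hxy => by simp only [hRdep hxy]
  have hlogP : DependsOn (fun x => Real.log (P x)) (Iio (n + M)) :=
    fun x y hxy => by simp only [hPdep hxy]
  have hpos := ae_measureReal_cyl_pos μ n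
  have h1 : ∫ x, Real.log (P x * (truncReturn n M x : ℝ) ^ s) ∂μ =
      -blockEntropy μ n + s * ∫ x, Real.log (truncReturn n M x) ∂μ := by
    rw [← integral_log_cyl, ← integral_const_mul, ← integral_add (integrable_of_dependsOn μ hlogP)
      ((integrable_of_dependsOn μ hlogR).const_mul s)]
    refine integral_congr_ae ?_
    filter_upwards [hpos] with x hx
    rw [Real.log_mul hx.ne' (Real.rpow_pos_of_pos (hr0 x) s).ne', Real.log_rpow (hr0 x)]
  rw [← h1]
  refine (exp_integral_log_le hfdep ?_).trans ?_
  · filter_upwards [hpos] with x hx using mul_pos hx (Real.rpow_pos_of_pos (hr0 x) s)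
  have hind : ∀ k : ℕ, Integrable (fun x => ((k + 1 : ℕ) : ℝ) ^ q *
      (P x * {x : X A | NoReturn n k x}.indicator 1 x)) μ := by
    intro k
    refine Integrable.const_mul ?_ _
    exact ((integrable_const (1 : ℝ)).indicator (measurableSet_noReturn n k)).bdd_mul
      (c := 1) (integrable_of_dependsOn μ hPdep).aestronglyMeasurable
      (ae_of_all _ fun x => by
        rw [Real.norm_of_nonneg measureReal_nonneg]
        exact measureReal_le_one)
  have h2 : ∑ k ∈ Finset.range M, ∑ w : Fin n → A,
      ((k + 1 : ℕ) : ℝ) ^ q * (μ.real (cyl A w) * μ.real (firstOccurrence w k)) =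
      ∫ x, ∑ k ∈ Finset.range M, ((k + 1 : ℕ) : ℝ) ^ q *
        (P x * {x : X A | NoReturn n k x}.indicator 1 x) ∂μ := by
    rw [integral_finsetSum _ fun k _ => hind k]
    refine Finset.sum_congr rfl fun k _ => ?_
    rw [integral_const_mul, integral_mul_indicator_eq_sum μ
      (fun w : Fin n → A => μ.real (cyl A w)) (measurableSet_noReturn n k), Finset.mul_sum]
    simp only [measureReal_cyl_inter_noReturn hμ]
  rw [h2]
  refine integral_mono (integrable_of_dependsOn μ hfdep)
    (integrable_finsetSum _ fun k _ => hind k) fun x => ?_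
  have hP0 : 0 ≤ P x := measureReal_nonneg
  calc P x * (truncReturn n M x : ℝ) ^ s
      ≤ P x * ∑ k ∈ Finset.range (truncReturn n M x), ((k + 1 : ℕ) : ℝ) ^ q := by
        gcongr
        exact rpow_le_sum_range_rpow hq hs (truncReturn_mem hM x).1
    _ = ∑ k ∈ Finset.range (truncReturn n M x), ((k + 1 : ℕ) : ℝ) ^ q *
          (P x * {x : X A | NoReturn n k x}.indicator 1 x) := by
        rw [Finset.mul_sum]
        refine Finset.sum_congr rfl fun k hk => ?_
        have : x ∈ {x : X A | NoReturn n k x} :=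
          noReturn_of_lt_truncReturn (Finset.mem_range.1 hk)
        rw [Set.indicator_of_mem this, Pi.one_apply]
        ring
    _ ≤ _ := by
        refine Finset.sum_le_sum_of_subset_of_nonneg
          (Finset.range_subset_range.2 (truncReturn_le hM x)) fun k _ _ => ?_
        have : 0 ≤ {x : X A | NoReturn n k x}.indicator (1 : X A → ℝ) x :=
          Set.indicator_nonneg (fun _ _ => zero_le_one) x
        positivity

lemma ae_exists_occurs {μ : Measure (X A)} [IsProbabilityMeasure μ] (herg : Ergodic (shift A) μ)
    {n : ℕ} {w : Fin n → A} (hw : 0 < μ.real (cyl A w)) : ∀ᵐ y ∂μ, ∃ j, Occurs w j y := by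
  set N : Set (X A) := {y | ∀ j, ¬ Occurs w j y} with hN
  have hNm : MeasurableSet N := by
    simp only [hN, ofPred_forall]
    exact MeasurableSet.iInter fun j => (measurableSet_occurs w j).compl
  have hsub : N ⊆ shift A ⁻¹' N := by
    intro y hy j hj
    refine hy (j + 1) fun i => ?_
    rw [add_right_comm]
    exact hj i
  rcases herg.ae_empty_or_univ_of_ae_le_preimage hNm.nullMeasurableSet hsub.eventuallyLE with h | h
  · filter_upwards [measure_eq_zero_iff_ae_notMem.1 (ae_eq_empty.1 h)] with y hy
    by_contra hne
    exact hy fun j hj => hne ⟨j, hj⟩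
  · have h1 : μ Nᶜ = 0 := ae_eq_univ.1 h
    have h2 : cyl A w ⊆ Nᶜ := fun y hy hyN => hyN 0 fun i => by
      rw [zero_add]
      exact hy i
    have h3 : μ.real (cyl A w) = 0 := by
      rw [measureReal_def, measure_mono_null h2 h1, ENNReal.toReal_zero]
    exact absurd h3 hw.ne'

lemma half_le_measureReal_avoid {μ : Measure (X A)} [IsProbabilityMeasure μ]
    (herg : Ergodic (shift A) μ) {n K : ℕ} {w : Fin n → A} (hw : 0 < μ.real (cyl A w))
    (hK : K * μ.real (cyl A w) ≤ 1 / 2) :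
    1 / 2 ≤ μ.real {y : X A | (∀ j < K, ¬ Occurs w j y) ∧ ∃ j, Occurs w j y} := by
  have hocc : ∀ j, μ.real {y : X A | Occurs w j y} = μ.real (cyl A w) := by
    intro j
    rw [← (measurePreserving_shift_iterate herg.toMeasurePreserving j).measureReal_preimage
      (measurableSet_cyl w).nullMeasurableSet]
    congr 1
    ext y
    simp [cyl, Occurs, add_comm]
  have h1 : μ.real {y : X A | (∀ j < K, ¬ Occurs w j y) ∧ ∃ j, Occurs w j y} =
      μ.real {y : X A | ∀ j < K, ¬ Occurs w j y} := by
    refine measureReal_congr ?_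
    filter_upwards [ae_exists_occurs herg hw] with y hy
    exact propext (and_iff_left hy)
  have h2 : {y : X A | ∀ j < K, ¬ Occurs w j y} =
      (⋃ j ∈ Finset.range K, {y : X A | Occurs w j y})ᶜ := by
    ext y
    simp
  have hm : MeasurableSet (⋃ j ∈ Finset.range K, {y : X A | Occurs w j y}) :=
    Finset.measurableSet_biUnion _ fun j _ => measurableSet_occurs w j
  have h3 := measureReal_biUnion_finset_le (μ := μ) (Finset.range K)
    fun j => {y : X A | Occurs w j y}
  simp only [hocc, Finset.sum_const, Finset.card_range, nsmul_eq_mul] at h3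
  rw [h1, h2, probReal_compl_eq_one_sub hm]
  linarith

lemma exp_le_hitMoment_of_pos {μ : Measure (X A)} [IsProbabilityMeasure μ]
    (herg : Ergodic (shift A) μ) {q : ℝ} (hq : 0 < q) (n : ℕ) :
    ENNReal.ofReal (Real.exp (q * blockEntropy μ n - (Real.log 2 + q * Real.log 2))) ≤
      hitMoment μ q n := by
  classical
  set P : (Fin n → A) → ℝ := fun w => μ.real (cyl A w) with hP
  have hP0 : ∀ w, 0 ≤ P w := fun w => measureReal_nonneg
  set K : (Fin n → A) → ℕ := fun w => ⌊(2 * P w)⁻¹⌋₊ with hK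
  set B : (Fin n → A) → Set (X A) :=
    fun w => {y | (∀ j < K w, ¬ Occurs w j y) ∧ ∃ j, Occurs w j y} with hB
  have hBm : ∀ w, MeasurableSet (B w) := by
    intro w
    refine (measurableSet_avoid w (K w)).inter ?_
    have hU : {y : X A | ∃ j, Occurs w j y} = ⋃ j, {y | Occurs w j y} := by
      ext y
      simp
    exact (hU ▸ MeasurableSet.iUnion fun j => measurableSet_occurs w j :
      MeasurableSet {y : X A | ∃ j, Occurs w j y})
  refine le_trans (ENNReal.ofReal_le_ofReal ?_) (sum_mul_le_lintegral_prod μ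
    (Finset.univ.filter fun w => 0 < P w) (s := fun w => cyl A w) (t := B)
    (c := fun w => (2 * P w)⁻¹ ^ q) measurableSet_cyl hBm
    (fun w => by have := hP0 w; positivity) (fun w _ w' _ hne => ?_) ?_)
  · have hdep : DependsOn (fun x : X A => 1 / 2 * (2 * P (restr n x))⁻¹ ^ q) (Iio n) :=
      dependsOn_comp_restr le_rfl fun w => 1 / 2 * (2 * P w)⁻¹ ^ q
    have hdep' : DependsOn (fun x : X A => Real.log (P (restr n x))) (Iio n) :=
      dependsOn_comp_restr le_rfl fun w => Real.log (P w)
    have hpos := ae_measureReal_cyl_pos μ n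
    have h1 : ∫ x, Real.log (1 / 2 * (2 * P (restr n x))⁻¹ ^ q) ∂μ =
        q * blockEntropy μ n - (Real.log 2 + q * Real.log 2) := by
      have h2 : ∫ x, (-(Real.log 2 + q * Real.log 2) + -q * Real.log (P (restr n x))) ∂μ =
          q * blockEntropy μ n - (Real.log 2 + q * Real.log 2) := by
        rw [integral_add (integrable_const _) ((integrable_of_dependsOn μ hdep').const_mul _),
          integral_const_mul, integral_log_cyl]
        simp only [integral_const, probReal_univ, one_smul]
        ring
      rw [← h2]
      refine integral_congr_ae ?_
      filter_upwards [hpos] with x hx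
      have hx : 0 < P (restr n x) := hx
      rw [Real.log_mul (by norm_num) (by positivity), Real.log_rpow (by positivity), Real.log_inv,
        Real.log_mul (by norm_num) hx.ne', one_div, Real.log_inv]
      ring
    rw [← h1]
    refine (exp_integral_log_le hdep ?_).trans ?_
    · filter_upwards [hpos] with x hx
      have hx : 0 < P (restr n x) := hx
      positivity
    · obtain ⟨z⟩ : Nonempty (X A) := μ.nonempty_of_neZero
      rw [integral_of_dependsOn μ hdep z, Finset.sum_filter]
      refine Finset.sum_le_sum fun w _ => ?_
      rw [restr_join]
      change P w * _ ≤ _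
      split_ifs with hw
      · have hhalf : 1 / 2 ≤ μ.real (B w) := by
          refine half_le_measureReal_avoid herg hw ?_
          have hfl : (K w : ℝ) ≤ (2 * P w)⁻¹ := Nat.floor_le (by positivity)
          calc (K w : ℝ) * P w ≤ (2 * P w)⁻¹ * P w := by gcongr
            _ = 1 / 2 := by field_simp
        calc P w * (1 / 2 * (2 * P w)⁻¹ ^ q) = (2 * P w)⁻¹ ^ q * (P w * (1 / 2)) := by ring
          _ ≤ (2 * P w)⁻¹ ^ q * (P w * μ.real (B w)) := by gcongr
      · have : P w = 0 := le_antisymm (not_lt.1 hw) (hP0 w)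
        rw [this, zero_mul]
  · exact Set.disjoint_prod.2 (Or.inl (disjoint_cyl hne))
  · rintro w hw ⟨x, y⟩ ⟨hx, hy⟩
    have hw : 0 < P w := (Finset.mem_filter.1 hw).2
    have hxw : (fun i : Fin n => x i.val) = w := funext hx
    simp only [hxw]
    refine ENNReal.ofReal_le_ofReal (Real.rpow_le_rpow (by positivity) ?_ hq.le)
    have h1 : K w + 1 ≤ hitTime A w y := lt_hitTime hy.1 hy.2
    have h2 : (2 * P w)⁻¹ < K w + 1 := Nat.lt_floor_add_one _
    have h3 : ((K w : ℝ) + 1) ≤ hitTime A w y := by exact_mod_cast h1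
    linarith

lemma le_liminf_log_of_exp_le {u : ℕ → ENNReal} {e : ℕ → ℝ} {l : ℝ}
    (he : Tendsto e atTop (𝓝 l))
    (hu : ∀ᶠ n : ℕ in atTop, ENNReal.ofReal (Real.exp (n * e n)) ≤ u n) :
    (l : EReal) ≤ atTop.liminf fun n : ℕ => (((n : ℝ)⁻¹ : ℝ) : EReal) * ENNReal.log (u n) := by
  have h1 : Tendsto (fun n => (e n : EReal)) atTop (𝓝 (l : EReal)) :=
    (continuous_coe_real_ereal.tendsto l).comp he
  rw [← h1.liminf_eq]
  refine liminf_le_liminf ?_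
  filter_upwards [hu, eventually_gt_atTop 0] with n hn hn0
  have hnr : (0 : ℝ) < n := by exact_mod_cast hn0
  have h2 : ENNReal.log (ENNReal.ofReal (Real.exp (n * e n))) = ((n * e n : ℝ) : EReal) := by
    rw [ENNReal.log_ofReal, if_neg (not_le.2 (Real.exp_pos _)), Real.log_exp]
  have h3 := ENNReal.log_monotone hn
  rw [h2] at h3
  have h4 : (e n : EReal) = (((n : ℝ)⁻¹ : ℝ) : EReal) * ((n * e n : ℝ) : EReal) := by
    rw [← EReal.coe_mul, inv_mul_cancel_left₀ hnr.ne']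
  rw [h4]
  exact mul_le_mul_of_nonneg_left h3 (by exact_mod_cast (inv_pos.2 hnr).le)

lemma tendsto_log_add_mul_div {b : ℝ} (hb : 0 < b) (a : ℝ) :
    Tendsto (fun n : ℕ => Real.log (a + b * n) / n) atTop (𝓝 0) := by
  have h1 : Tendsto (fun n : ℕ => a + b * (n : ℝ)) atTop atTop :=
    tendsto_atTop_add_const_left _ _ (tendsto_natCast_atTop_atTop.const_mul_atTop hb)
  have h2 : Tendsto (fun n : ℕ => Real.log (a + b * n) / (a + b * n)) atTop (𝓝 0) :=
    Real.isLittleO_log_id_atTop.tendsto_div_nhds_zero.comp h1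
  have h3 : Tendsto (fun n : ℕ => a / (n : ℝ) + b) atTop (𝓝 (0 + b)) :=
    (tendsto_const_div_atTop_nhds_zero_nat a).add tendsto_const_nhds
  have h4 := h2.mul h3
  rw [zero_mul] at h4
  refine h4.congr' ?_
  filter_upwards [eventually_gt_atTop 0, h1.eventually_gt_atTop 0] with n hn hpos
  have hnr : (0 : ℝ) < n := by exact_mod_cast hn
  field_simp

lemma tendsto_coding_overhead {a : ℕ} (ha : 1 < a) :
    Tendsto (fun n : ℕ => (Real.log (2 + Real.log (a ^ (2 * n) : ℕ)) +
      n * Real.log a * ((a : ℝ) ^ n / (a ^ (2 * n) : ℕ))) / n) atTop (𝓝 0) := by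
  have har : (1 : ℝ) < a := by exact_mod_cast ha
  have hlog : 0 < Real.log a := Real.log_pos har
  have h1 := tendsto_log_add_mul_div (b := 2 * Real.log a) (by positivity) 2
  have h2 : Tendsto (fun n : ℕ => Real.log a * ((a : ℝ)⁻¹) ^ n) atTop (𝓝 (Real.log a * 0)) :=
    (tendsto_pow_atTop_nhds_zero_of_lt_one (by positivity) (inv_lt_one_of_one_lt₀ har)).const_mul _
  have h3 := h1.add h2
  rw [mul_zero, add_zero] at h3
  refine h3.congr' ?_
  filter_upwards [eventually_gt_atTop 0] with n hn
  have hnr : (0 : ℝ) < n := by exact_mod_cast hn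
  have hpow : (a : ℝ) ^ n / (a ^ (2 * n) : ℕ) = ((a : ℝ)⁻¹) ^ n := by
    push_cast
    rw [two_mul, pow_add, inv_pow]
    field_simp
  have hlogpow : Real.log (a ^ (2 * n) : ℕ) = 2 * Real.log a * n := by
    push_cast
    rw [Real.log_pow]
    push_cast
    ring
  rw [hpow, hlogpow]
  field_simp

end Helpers

/-- for an ergodic shift-invariant probability measure `μ`,
`q·h(μ) ≤ liminf_n (1/n) log ∬ T_{x_1^n}(y)^q d(μ ⊗ μ)(x,y)` for every `q ∈ ℝ`. -/
theorem hitting_time_spectrum_entropy_lower_bound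
    (hcard : 1 < Fintype.card A)
    (μ : Measure (X A)) [IsProbabilityMeasure μ] (herg : Ergodic (shift A) μ)
    (q : ℝ) (h : ℝ) (hent : Tendsto (entSeq A μ) atTop (nhds h)) :
    ((q * h : ℝ) : EReal) ≤ atTop.liminf (fun n : ℕ =>
      (((n : ℝ)⁻¹ : ℝ) : EReal) * ENNReal.log
        (∫⁻ p : X A × X A, ENNReal.ofReal
          ((hitTime A (fun i : Fin n => p.1 i.val) p.2 : ℝ) ^ q) ∂(μ.prod μ))) := by
  have hμ := herg.toMeasurePreserving
  have hA : Nonempty A := Fintype.card_pos_iff.1 (zero_lt_one.trans hcard)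
  change _ ≤ atTop.liminf fun n : ℕ => (((n : ℝ)⁻¹ : ℝ) : EReal) * ENNReal.log (hitMoment μ q n)
  rcases lt_trichotomy q 0 with hq | rfl | hq
  · obtain ⟨s, hs⟩ : ∃ s, s = max (1 + q) 0 := ⟨_, rfl⟩
    have hh : 0 ≤ h := ge_of_tendsto' hent fun n => by
      rw [entSeq_eq]
      exact div_nonneg (blockEntropy_nonneg μ n) (Nat.cast_nonneg n)
    have hs0 : 0 ≤ s := hs ▸ le_max_right _ _
    have hsq : 1 + q ≤ s := hs ▸ le_max_left _ _
    have hlim := hent.neg.add (((tendsto_coding_overhead hcard).const_sub h).const_mul s)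
    refine le_trans (EReal.coe_le_coe_iff.2 ?_) (le_liminf_log_of_exp_le hlim ?_)
    · nlinarith
    · filter_upwards [eventually_gt_atTop 0] with n hn
      have hM : 1 ≤ Fintype.card A ^ (2 * n) := Nat.one_le_pow _ _ Fintype.card_pos
      refine le_trans (ENNReal.ofReal_le_ofReal (Real.exp_le_exp.2 ?_))
        (exp_le_hitMoment_of_neg hμ hq hs n hM)
      have hnr : (0 : ℝ) < n := by exact_mod_cast hn
      have hb := mul_entropy_le_integral_log_truncReturn hμ hent hn hM
      rw [entSeq_eq, mul_add, mul_neg, mul_div_cancel₀ _ hnr.ne', mul_left_comm, mul_sub,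
        mul_div_cancel₀ _ hnr.ne']
      gcongr
      linarith
  · rw [zero_mul]
    refine le_liminf_log_of_exp_le (e := fun _ => 0) tendsto_const_nhds (Eventually.of_forall ?_)
    intro n
    simp [hitMoment]
  · have hlim := (hent.const_mul q).sub
      (tendsto_const_div_atTop_nhds_zero_nat (Real.log 2 + q * Real.log 2))
    rw [sub_zero] at hlim
    refine le_liminf_log_of_exp_le hlim ?_
    filter_upwards [eventually_gt_atTop 0] with n hn
    have hnr : (n : ℝ) ≠ 0 := by exact_mod_cast hn.ne'
    refine le_trans (le_of_eq ?_) (exp_le_hitMoment_of_pos herg hq n)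
    rw [entSeq_eq]
    congr 2
    field_simp

end RTSpec
end

section
/- Let φ : X → ℝ be a normalized potential with summable variation, with unique equilibrium state μ_φ. Then the equation lim_n (1/n) log Σ_{a_1^n ∈ A^n} μ_φ(a_1^n)^{1−q} = sup_η ∫ φ dη (where the limit on the left exists for every q ∈ ℝ and the supremum is over all shift-invariant Borel probability measures η) has a unique solution q*_φ in ℝ. Moreover q*_φ ∈ [−1, 0), and q*_φ = −1 if and only if φ = u − u∘θ − log|A| for some continuous function u : X → ℝ. -/
open MeasureTheory Filter Topology Set

namespace RTSpec

variable (A : Type*) [Fintype A] [TopologicalSpace A] [DiscreteTopology A]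
  [MeasurableSpace A] [BorelSpace A]

section Words

variable {α : Type*}

/-- The sequence obtained by placing the word `w` in front of `x`. -/
def glue {n : ℕ} (w : Fin n → α) (x : X α) : X α :=
  fun i => if h : i < n then w ⟨i, h⟩ else x (i - n)

lemma prepend_shift (x : X α) : prepend α (x 0) (shift α x) = x := by
  funext i
  cases i <;> rfl

lemma shift_iterate_apply (n : ℕ) (x : X α) (i : ℕ) : (shift α)^[n] x i = x (i + n) := by
  induction n generalizing x with
  | zero => rfl
  | succ n ih =>
    rw [Function.iterate_succ_apply, ih]
    rfl

lemma glue_zero (w : Fin 0 → α) (x : X α) : glue w x = x := by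
  funext i
  simp [glue]

lemma glue_cons {n : ℕ} (a : α) (w : Fin n → α) (x : X α) :
    glue (Fin.cons a w : Fin (n + 1) → α) x = prepend α a (glue w x) := by
  funext i
  cases i with
  | zero => simp [glue, prepend]
  | succ i =>
    change (if h : i + 1 < n + 1 then _ else x (i + 1 - (n + 1))) =
      if h : i < n then w ⟨i, h⟩ else x (i - n)
    by_cases h : i < n
    · rw [dif_pos (Nat.succ_lt_succ h), dif_pos h]
      rfl
    · rw [dif_neg (by omega), dif_neg h, Nat.add_sub_add_right]

lemma shift_iterate_glue {n : ℕ} (w : Fin n → α) (x : X α) : (shift α)^[n] (glue w x) = x := by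
  funext i
  simp [shift_iterate_apply, glue]

lemma glue_mem_cyl {n : ℕ} (w : Fin n → α) (x : X α) : glue w x ∈ cyl α w := by
  intro i
  simp [glue]

lemma glue_shift_iterate (n : ℕ) (x : X α) :
    glue (fun i : Fin n => x i) ((shift α)^[n] x) = x := by
  funext i
  by_cases h : i < n
  · simp [glue, h]
  · simp [glue, h, shift_iterate_apply, Nat.sub_add_cancel (not_lt.mp h)]

lemma glue_eq_of_lt {n k : ℕ} (w : Fin n → α) {x y : X α} (h : ∀ i < k, x i = y i) :
    ∀ i < n + k, glue w x i = glue w y i := by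
  intro i hi
  by_cases hn : i < n
  · simp [glue, hn]
  · simp only [glue, hn, dite_false]
    exact h _ (by omega)

lemma eq_of_mem_cyl {n : ℕ} {w : Fin n → α} {x y : X α} (hx : x ∈ cyl α w) (hy : y ∈ cyl α w) :
    ∀ i < n, x i = y i :=
  fun i hi => (hx ⟨i, hi⟩).trans (hy ⟨i, hi⟩).symm

lemma glue_mem_cyl_iff {n : ℕ} (v w : Fin n → α) (x : X α) : glue v x ∈ cyl α w ↔ v = w := by
  constructor
  · intro h
    funext i
    rw [← h i, ← glue_mem_cyl v x i]
  · rintro rfl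
    exact glue_mem_cyl _ _

end Words

section Continuity

variable {α : Type*} [TopologicalSpace α]

lemma continuous_shift : Continuous (shift α) :=
  continuous_pi fun n => continuous_apply (n + 1)

lemma continuous_prepend (a : α) : Continuous (prepend α a) := by
  refine continuous_pi fun n => ?_
  cases n with
  | zero => exact continuous_const
  | succ n => exact continuous_apply n

lemma continuous_glue {n : ℕ} (w : Fin n → α) : Continuous (glue w) := by
  refine continuous_pi fun i => ?_
  by_cases h : i < n
  · simp only [glue, h, dite_true]
    exact continuous_const
  · simp only [glue, h, dite_false]
    exact continuous_apply _

lemma continuous_birkhoffSum_shift {φ : X α → ℝ} (hφ : Continuous φ) (n : ℕ) :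
    Continuous (birkhoffSum (shift α) φ n) := by
  unfold birkhoffSum
  exact continuous_finsetSum _ fun i _ => hφ.comp (continuous_shift.iterate i)

variable [DiscreteTopology α]

lemma isOpen_setOf_forall_lt_eq (x : X α) (k : ℕ) : IsOpen {y : X α | ∀ i < k, y i = x i} := by
  have : {y : X α | ∀ i < k, y i = x i} = ⋂ i ∈ Finset.range k, (fun y : X α => y i) ⁻¹' {x i} := by
    ext y
    simp
  rw [this]
  exact isOpen_biInter_finset fun i _ => (isOpen_discrete _).preimage (continuous_apply i)

lemma isClopen_cyl {n : ℕ} (w : Fin n → α) : IsClopen (cyl α w) := by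
  have : cyl α w = ⋂ i : Fin n, (fun y : X α => y i) ⁻¹' {w i} := by
    ext y
    simp [cyl]
  rw [this]
  exact isClopen_iInter_of_finite fun i => (isClopen_discrete _).preimage (continuous_apply _)

lemma continuous_of_modulus {u : X α → ℝ} {T : ℕ → ℝ} (hT : Tendsto T atTop (𝓝 0))
    (h : ∀ k x y, (∀ i < k, x i = y i) → |u x - u y| ≤ T k) : Continuous u := by
  rw [continuous_iff_continuousAt]
  intro x
  rw [ContinuousAt, Metric.tendsto_nhds]
  intro ε hε
  obtain ⟨k, hk⟩ := (hT.eventually (gt_mem_nhds hε)).exists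
  filter_upwards [(isOpen_setOf_forall_lt_eq x k).mem_nhds fun i _ => rfl] with y hy
  rw [Real.dist_eq]
  exact (h k y x hy).trans_lt hk

omit [DiscreteTopology α] in
lemma exists_cyl_lt_of_pos {χ : X α → ℝ} (hχ : Continuous χ) {x : X α} (hx : 0 < χ x) :
    ∃ k : ℕ, 1 ≤ k ∧ ∃ δ > 0, ∀ y ∈ cyl α (fun i : Fin k => x i), δ ≤ χ y := by
  have hU : χ ⁻¹' Ioi (χ x / 2) ∈ 𝓝 x :=
    (isOpen_Ioi.preimage hχ).mem_nhds (by simp only [mem_preimage, mem_Ioi]; linarith)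
  rw [nhds_pi, Filter.mem_pi] at hU
  obtain ⟨I, hI, t, ht, hsub⟩ := hU
  obtain ⟨N, hN⟩ := hI.bddAbove
  refine ⟨N + 1, by omega, χ x / 2, by linarith, fun y hy => ?_⟩
  refine le_of_lt (hsub fun i hi => ?_)
  have : y i = x i := hy ⟨i, Nat.lt_succ_of_le (hN hi)⟩
  rw [this]
  exact mem_of_mem_nhds (ht i)

end Continuity

section Variation

variable {α : Type*} [Fintype α] [TopologicalSpace α] {φ : X α → ℝ}

lemma exists_abs_le (hφ : Continuous φ) : ∃ B, 0 ≤ B ∧ ∀ x, |φ x| ≤ B := by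
  obtain ⟨B, hB⟩ := isCompact_univ.exists_bound_of_continuousOn hφ.continuousOn
  exact ⟨max B 0, le_max_right _ _, fun x => (hB x (mem_univ x)).trans (le_max_left _ _)⟩

lemma abs_sub_le_Var (hφ : Continuous φ) {n : ℕ} {x y : X α} (h : ∀ i < n, x i = y i) :
    |φ x - φ y| ≤ Var α φ n := by
  obtain ⟨B, -, hB⟩ := exists_abs_le hφ
  refine le_csSup ⟨B + B, ?_⟩ ⟨x, y, h, rfl⟩
  rintro r ⟨x, y, -, rfl⟩
  exact (abs_sub _ _).trans (add_le_add (hB x) (hB y))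

omit [Fintype α] [TopologicalSpace α] in
lemma Var_nonneg (n : ℕ) : 0 ≤ Var α φ n := by
  refine Real.sSup_nonneg ?_
  rintro r ⟨x, y, -, rfl⟩
  exact abs_nonneg _

/-- The tail `∑_{j > k} var_j(φ)` of the series of variations. -/
noncomputable def tailVar (φ : X α → ℝ) (k : ℕ) : ℝ := ∑' j, Var α φ (j + k + 1)

omit [Fintype α] [TopologicalSpace α] in
lemma tendsto_tailVar : Tendsto (tailVar φ) atTop (𝓝 0) :=
  tendsto_sum_nat_add fun n => Var α φ (n + 1)

omit [Fintype α] [TopologicalSpace α] in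
lemma tailVar_nonneg (k : ℕ) : 0 ≤ tailVar φ k :=
  tsum_nonneg fun _ => Var_nonneg _

lemma abs_birkhoffSum_sub_le (hφ : Continuous φ) (hvar : Summable fun n => Var α φ (n + 1))
    {n k : ℕ} {x y : X α} (h : ∀ i < n + k, x i = y i) :
    |birkhoffSum (shift α) φ n x - birkhoffSum (shift α) φ n y| ≤ tailVar φ k := by
  calc |birkhoffSum (shift α) φ n x - birkhoffSum (shift α) φ n y|
      ≤ ∑ i ∈ Finset.range n, |φ ((shift α)^[i] x) - φ ((shift α)^[i] y)| := by
        rw [birkhoffSum, birkhoffSum, ← Finset.sum_sub_distrib]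
        exact Finset.abs_sum_le_sum_abs _ _
    _ ≤ ∑ i ∈ Finset.range n, Var α φ ((n - 1 - i) + k + 1) := by
        refine Finset.sum_le_sum fun i hi => abs_sub_le_Var hφ fun j hj => ?_
        rw [Finset.mem_range] at hi
        rw [shift_iterate_apply, shift_iterate_apply]
        exact h _ (by omega)
    _ = ∑ i ∈ Finset.range n, Var α φ (i + k + 1) :=
        Finset.sum_range_reflect (fun i => Var α φ (i + k + 1)) n
    _ ≤ tailVar φ k := by
        refine Summable.sum_le_tsum _ (fun _ _ => Var_nonneg _) ?_
        exact (summable_nat_add_iff (f := fun n => Var α φ (n + 1)) k).mpr hvar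

lemma abs_birkhoffSum_sub_le_of_mem_cyl (hφ : Continuous φ)
    (hvar : Summable fun n => Var α φ (n + 1)) {n : ℕ} {w : Fin n → α} {x y : X α}
    (hx : x ∈ cyl α w) (hy : y ∈ cyl α w) :
    |birkhoffSum (shift α) φ n x - birkhoffSum (shift α) φ n y| ≤ tailVar φ 0 :=
  abs_birkhoffSum_sub_le hφ hvar (k := 0) (eq_of_mem_cyl hx hy)

lemma exists_forall_le_neg (hcard : 1 < Fintype.card α) (hφ : Continuous φ)
    (hnorm : Normalized α φ) : ∃ δ > 0, ∀ x, φ x ≤ -δ := by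
  have hneg : ∀ x, φ x < 0 := by
    intro x
    have : Nontrivial α := Fintype.one_lt_card_iff_nontrivial.mp hcard
    obtain ⟨b, hb⟩ := exists_ne (x 0)
    have h1 : Real.exp (φ (prepend α (x 0) (shift α x))) <
        ∑ a, Real.exp (φ (prepend α a (shift α x))) :=
      Finset.single_lt_sum (f := fun a => Real.exp (φ (prepend α a (shift α x)))) hb (Finset.mem_univ _) (Finset.mem_univ _) (Real.exp_pos _)
        fun _ _ _ => (Real.exp_pos _).le
    rwa [hnorm, prepend_shift, Real.exp_lt_one_iff] at h1
  have : Nonempty α := Fintype.card_pos_iff.mp (by omega)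
  obtain ⟨x, -, hx⟩ := isCompact_univ.exists_isMaxOn univ_nonempty hφ.continuousOn
  exact ⟨-φ x, neg_pos.mpr (hneg x), fun y => by simpa using hx (mem_univ y)⟩

omit [TopologicalSpace α] in
lemma sum_exp_birkhoffSum_glue (hnorm : Normalized α φ) (n : ℕ) (x : X α) :
    ∑ w : Fin n → α, Real.exp (birkhoffSum (shift α) φ n (glue w x)) = 1 := by
  induction n with
  | zero => simp
  | succ n ih =>
    rw [← ih, ← (Fin.consEquiv fun _ => α).sum_comp, Fintype.sum_prod_type_right]
    refine Finset.sum_congr rfl fun w _ => ?_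
    have : ∀ a : α, Real.exp (birkhoffSum (shift α) φ (n + 1)
        (glue ((Fin.consEquiv fun _ => α) (a, w)) x)) =
        Real.exp (φ (prepend α a (glue w x))) * Real.exp (birkhoffSum (shift α) φ n (glue w x)) := by
      intro a
      rw [← Real.exp_add, birkhoffSum_succ']
      change Real.exp (φ (glue (Fin.cons a w : Fin (n + 1) → α) x) + birkhoffSum (shift α) φ n
        (shift α (glue (Fin.cons a w : Fin (n + 1) → α) x))) = _
      rw [glue_cons]
      rfl
    simp_rw [this]
    rw [← Finset.sum_mul, hnorm, one_mul]

end Variation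

section Measure

variable {α : Type*} [Fintype α] [TopologicalSpace α] [DiscreteTopology α]
  [MeasurableSpace α] [BorelSpace α] {φ : X α → ℝ} {μ : Measure (X α)}

lemma integrable_of_continuous [IsFiniteMeasure μ] {f : X α → ℝ} (hf : Continuous f) :
    Integrable f μ :=
  hf.integrable_of_hasCompactSupport (HasCompactSupport.of_compactSpace f)

lemma measurable_shift : Measurable (shift α) := continuous_shift.measurable

/-- The integral of `f` equals that of the `n`-th iterate of the transfer operator on `f`. -/
lemma IsEqSt.integral_eq_sum (hφ : Continuous φ) (hμ : IsEqSt α φ μ) (n : ℕ) {f : X α → ℝ}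
    (hf : Continuous f) :
    ∫ x, f x ∂μ =
      ∑ w : Fin n → α, ∫ x, Real.exp (birkhoffSum (shift α) φ n (glue w x)) * f (glue w x) ∂μ := by
  have := hμ.1
  induction n generalizing f with
  | zero => simp [glue_zero]
  | succ n ih =>
    have hL : Continuous fun x => ∑ a : α, Real.exp (φ (prepend α a x)) * f (prepend α a x) :=
      continuous_finsetSum _ fun a _ => ((hφ.comp (continuous_prepend a)).rexp).mul
        (hf.comp (continuous_prepend a))
    rw [← hμ.2 f hf, ih hL, ← (Fin.consEquiv fun _ => α).sum_comp, Fintype.sum_prod_type_right]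
    refine Finset.sum_congr rfl fun w _ => ?_
    have key : ∀ a x, Real.exp (birkhoffSum (shift α) φ (n + 1)
        (glue ((Fin.consEquiv fun _ => α) (a, w)) x)) * f (glue ((Fin.consEquiv fun _ => α) (a, w)) x) =
        Real.exp (birkhoffSum (shift α) φ n (glue w x)) *
          (Real.exp (φ (prepend α a (glue w x))) * f (prepend α a (glue w x))) := by
      intro a x
      change Real.exp (birkhoffSum (shift α) φ (n + 1) (glue (Fin.cons a w : Fin (n + 1) → α) x)) *
        f (glue (Fin.cons a w : Fin (n + 1) → α) x) = _
      rw [glue_cons, birkhoffSum_succ', Real.exp_add]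
      change _ * Real.exp (birkhoffSum (shift α) φ n (glue w x)) * _ = _
      ring
    simp_rw [key, Finset.mul_sum]
    refine integral_finsetSum _ fun a _ => integrable_of_continuous ?_
    exact (((continuous_birkhoffSum_shift hφ n).comp (continuous_glue w)).rexp).mul
      (((hφ.comp ((continuous_prepend a).comp (continuous_glue w))).rexp).mul
        (hf.comp ((continuous_prepend a).comp (continuous_glue w))))

lemma IsEqSt.measureReal_cyl (hφ : Continuous φ) (hμ : IsEqSt α φ μ) {n : ℕ} (w : Fin n → α) :
    μ.real (cyl α w) = ∫ x, Real.exp (birkhoffSum (shift α) φ n (glue w x)) ∂μ := by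
  have := hμ.1
  have hcl := isClopen_cyl w
  rw [← integral_indicator_one hcl.isOpen.measurableSet,
    hμ.integral_eq_sum hφ n (hcl.continuous_indicator continuous_one),
    Finset.sum_eq_single_of_mem w (Finset.mem_univ _)]
  · simp [indicator_of_mem (glue_mem_cyl w _)]
  · intro v _ hv
    have : ∀ x, glue v x ∉ cyl α w := fun x h => hv ((glue_mem_cyl_iff v w x).mp h)
    simp [this]

lemma IsEqSt.sum_measureReal_cyl (hφ : Continuous φ) (hnorm : Normalized α φ)
    (hμ : IsEqSt α φ μ) (n : ℕ) : ∑ w : Fin n → α, μ.real (cyl α w) = 1 := by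
  have := hμ.1
  simp_rw [hμ.measureReal_cyl hφ]
  rw [← integral_finsetSum]
  · simp [sum_exp_birkhoffSum_glue hnorm]
  · exact fun w _ => integrable_of_continuous
      ((continuous_birkhoffSum_shift hφ n).comp (continuous_glue w)).rexp

lemma integral_mem_Icc [IsProbabilityMeasure μ] {f : X α → ℝ} (hf : Continuous f) {a b : ℝ}
    (ha : ∀ x, a ≤ f x) (hb : ∀ x, f x ≤ b) : ∫ x, f x ∂μ ∈ Icc a b := by
  constructor
  · simpa using integral_mono (integrable_const a) (integrable_of_continuous (μ := μ) hf) ha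
  · simpa using integral_mono (integrable_of_continuous (μ := μ) hf) (integrable_const b) hb

lemma IsEqSt.measureReal_cyl_mem_Icc (hφ : Continuous φ)
    (hvar : Summable fun n => Var α φ (n + 1)) (hμ : IsEqSt α φ μ) {n : ℕ} {w : Fin n → α}
    {y : X α} (hy : y ∈ cyl α w) :
    μ.real (cyl α w) ∈ Icc (Real.exp (birkhoffSum (shift α) φ n y - tailVar φ 0))
      (Real.exp (birkhoffSum (shift α) φ n y + tailVar φ 0)) := by
  have := hμ.1
  have h := fun x => abs_le.mp
    (abs_birkhoffSum_sub_le_of_mem_cyl hφ hvar (glue_mem_cyl w x) hy)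
  rw [hμ.measureReal_cyl hφ]
  refine integral_mem_Icc ((continuous_birkhoffSum_shift hφ n).comp (continuous_glue w)).rexp
    (fun x => Real.exp_le_exp.mpr ?_) (fun x => Real.exp_le_exp.mpr ?_)
  · rw [Function.comp_apply]
    linarith [(h x).1]
  · rw [Function.comp_apply]
    linarith [(h x).2]

lemma IsEqSt.measureReal_cyl_pos (hφ : Continuous φ)
    (hvar : Summable fun n => Var α φ (n + 1)) (hμ : IsEqSt α φ μ) {n : ℕ} (w : Fin n → α) :
    0 < μ.real (cyl α w) := by
  have := hμ.1
  obtain ⟨x⟩ := nonempty_of_isProbabilityMeasure μ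
  exact (Real.exp_pos _).trans_le (hμ.measureReal_cyl_mem_Icc hφ hvar (glue_mem_cyl w x)).1

lemma IsEqSt.abs_log_measureReal_cyl_sub_le (hφ : Continuous φ)
    (hvar : Summable fun n => Var α φ (n + 1)) (hμ : IsEqSt α φ μ) {n : ℕ} {w : Fin n → α}
    {y : X α} (hy : y ∈ cyl α w) :
    |Real.log (μ.real (cyl α w)) - birkhoffSum (shift α) φ n y| ≤ tailVar φ 0 := by
  have h := hμ.measureReal_cyl_mem_Icc hφ hvar hy
  have hpos := hμ.measureReal_cyl_pos hφ hvar w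
  have h1 := (Real.le_log_iff_exp_le hpos).mpr h.1
  have h2 := (Real.log_le_iff_le_exp hpos).mpr h.2
  rw [abs_le]
  constructor <;> linarith

lemma IsEqSt.abs_log_measureReal_cyl_append_sub_le (hφ : Continuous φ)
    (hvar : Summable fun n => Var α φ (n + 1)) (hμ : IsEqSt α φ μ) {m n : ℕ} (w : Fin m → α)
    (v : Fin n → α) :
    |Real.log (μ.real (cyl α (Fin.append w v))) -
      (Real.log (μ.real (cyl α w)) + Real.log (μ.real (cyl α v)))| ≤ 3 * tailVar φ 0 := by
  have := hμ.1
  obtain ⟨x⟩ := nonempty_of_isProbabilityMeasure μ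
  set y := glue (Fin.append w v) x
  have hy : y ∈ cyl α (Fin.append w v) := glue_mem_cyl _ _
  have hyw : y ∈ cyl α w := by
    intro i
    rw [← Fin.append_left w v i, ← hy]
    rfl
  have hyv : (shift α)^[m] y ∈ cyl α v := by
    intro i
    rw [← Fin.append_right w v i, ← hy, shift_iterate_apply, add_comm]
    rfl
  have h1 := abs_le.mp (hμ.abs_log_measureReal_cyl_sub_le hφ hvar hy)
  have h2 := abs_le.mp (hμ.abs_log_measureReal_cyl_sub_le hφ hvar hyw)
  have h3 := abs_le.mp (hμ.abs_log_measureReal_cyl_sub_le hφ hvar hyv)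
  rw [birkhoffSum_add] at h1
  rw [abs_le]
  constructor <;> linarith [h1.1, h1.2, h2.1, h2.2, h3.1, h3.2]

end Measure

section MaximalIntegral

variable {α : Type*} [Fintype α] [TopologicalSpace α] [DiscreteTopology α]
  [MeasurableSpace α] [BorelSpace α] {φ : X α → ℝ}

/-- The uniform probability measure on the first `n` points of the orbit of `p`. -/
noncomputable def orbitMeasure (n : ℕ) (p : X α) : Measure (X α) :=
  (n : ENNReal)⁻¹ • ∑ i ∈ Finset.range n, Measure.dirac ((shift α)^[i] p)

omit [Fintype α] [TopologicalSpace α] [DiscreteTopology α] [BorelSpace α] in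
lemma isProbabilityMeasure_orbitMeasure {n : ℕ} (hn : n ≠ 0) (p : X α) :
    IsProbabilityMeasure (orbitMeasure n p) := by
  constructor
  simp only [orbitMeasure, Measure.smul_apply, Measure.finsetSum_apply, measure_univ,
    Finset.sum_const, Finset.card_range, smul_eq_mul, nsmul_eq_mul, mul_one]
  exact ENNReal.inv_mul_cancel (by exact_mod_cast hn) (ENNReal.natCast_ne_top n)

lemma invProb_orbitMeasure {n : ℕ} (hn : n ≠ 0) {p : X α} (hp : (shift α)^[n] p = p) :
    InvProb α (orbitMeasure n p) := by
  refine ⟨isProbabilityMeasure_orbitMeasure hn p, ?_⟩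
  ext s hs
  rw [Measure.map_apply measurable_shift hs]
  simp only [orbitMeasure, Measure.smul_apply, Measure.finsetSum_apply,
    Measure.dirac_apply' _ hs, Measure.dirac_apply' _ (measurable_shift hs)]
  congr 1
  have h := Finset.sum_range_succ' (fun i => s.indicator (1 : X α → ENNReal) ((shift α)^[i] p)) n
  rw [Finset.sum_range_succ, hp] at h
  have h' := (ENNReal.add_left_inj (by simp [indicator]; split_ifs <;> simp)).mp h
  rw [h']
  refine Finset.sum_congr rfl fun i _ => ?_
  rw [Function.iterate_succ_apply']
  rfl

lemma integral_orbitMeasure (hφ : Continuous φ) (n : ℕ) (p : X α) :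
    ∫ x, φ x ∂(orbitMeasure n p) = (n : ℝ)⁻¹ * birkhoffSum (shift α) φ n p := by
  rw [orbitMeasure, integral_smul_measure, integral_finsetSum_measure]
  · simp [birkhoffSum, integral_dirac' _ _ hφ.stronglyMeasurable]
  · exact fun i _ => integrable_of_continuous hφ

lemma bddAbove_integral (hφ : Continuous φ) :
    BddAbove {r | ∃ η : Measure (X α), InvProb α η ∧ r = ∫ x, φ x ∂η} := by
  obtain ⟨B, -, hB⟩ := exists_abs_le hφ
  refine ⟨B, ?_⟩
  rintro r ⟨η, hη, rfl⟩
  have := hη.1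
  exact (integral_mem_Icc hφ (fun x => (abs_le.mp (hB x)).1) fun x => (abs_le.mp (hB x)).2).2

lemma birkhoffSum_le_supInt (hφ : Continuous φ) (hvar : Summable fun n => Var α φ (n + 1))
    (n : ℕ) (x : X α) : birkhoffSum (shift α) φ n x ≤ n * supInt α φ + tailVar φ 0 := by
  rcases Nat.eq_zero_or_pos n with rfl | hn
  · simpa using tailVar_nonneg 0
  have hp : (shift α)^[n] (fun i => x (i % n)) = fun i => x (i % n) := by
    funext i
    simp [shift_iterate_apply]
  have h1 : (n : ℝ)⁻¹ * birkhoffSum (shift α) φ n (fun i => x (i % n)) ≤ supInt α φ := by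
    rw [← integral_orbitMeasure hφ]
    exact le_csSup (bddAbove_integral hφ) ⟨_, invProb_orbitMeasure hn.ne' hp, rfl⟩
  rw [inv_mul_le_iff₀ (by exact_mod_cast hn)] at h1
  have h2 := (abs_le.mp (abs_birkhoffSum_sub_le hφ hvar (n := n) (k := 0) (x := x)
    (y := fun i => x (i % n)) fun i hi => by rw [Nat.mod_eq_of_lt (show i < n from hi)])).2
  linarith

lemma supInt_le [Nonempty α] {r : ℝ}
    (h : ∀ η : Measure (X α), InvProb α η → ∫ x, φ x ∂η ≤ r) : supInt α φ ≤ r := by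
  have a : α := Classical.arbitrary α
  have hp : (shift α)^[1] (fun _ => a) = fun _ => a := rfl
  refine csSup_le ⟨_, _, invProb_orbitMeasure one_ne_zero hp, rfl⟩ ?_
  rintro r ⟨η, hη, rfl⟩
  exact h η hη

end MaximalIntegral

section Spectrum

variable {α : Type*} [Fintype α] [MeasurableSpace α] {φ : X α → ℝ} {μ : Measure (X α)}

/-- The partition function `∑_w μ(w)^t` over words of length `n`. -/
noncomputable def partFn (μ : Measure (X α)) (t : ℝ) (n : ℕ) : ℝ :=
  ∑ w : Fin n → α, Real.exp (t * Real.log (μ.real (cyl α w)))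

lemma partFn_pos [Nonempty α] (t : ℝ) (n : ℕ) : 0 < partFn μ t n :=
  Finset.sum_pos (fun _ _ => Real.exp_pos _) Finset.univ_nonempty

lemma exp_mul_partFn_le {t t' a b : ℝ} {n : ℕ}
    (h : ∀ w : Fin n → α, (t' - t) * Real.log (μ.real (cyl α w)) ∈ Icc a b) :
    Real.exp a * partFn μ t n ≤ partFn μ t' n ∧ partFn μ t' n ≤ Real.exp b * partFn μ t n := by
  simp only [partFn, Finset.mul_sum, ← Real.exp_add]
  constructor <;> refine Finset.sum_le_sum fun w _ => Real.exp_le_exp.mpr ?_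
  · linarith [(h w).1]
  · linarith [(h w).2]

lemma partFn_add_le {t D : ℝ} {m n : ℕ}
    (h : ∀ (w : Fin m → α) (v : Fin n → α), |Real.log (μ.real (cyl α (Fin.append w v))) -
      (Real.log (μ.real (cyl α w)) + Real.log (μ.real (cyl α v)))| ≤ D) :
    partFn μ t (m + n) ≤ Real.exp (|t| * D) * (partFn μ t m * partFn μ t n) := by
  rw [partFn, partFn, partFn, Finset.sum_mul_sum, ← (Fin.appendEquiv m n).sum_comp,
    Fintype.sum_prod_type, Finset.mul_sum]
  refine Finset.sum_le_sum fun w _ => ?_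
  rw [Finset.mul_sum]
  refine Finset.sum_le_sum fun v _ => ?_
  rw [← Real.exp_add, ← Real.exp_add, Real.exp_le_exp]
  change t * Real.log (μ.real (cyl α (Fin.append w v))) ≤ _
  have h1 := (le_abs_self _).trans ((abs_mul t _).le.trans
    (mul_le_mul_of_nonneg_left (h w v) (abs_nonneg t)))
  linarith

lemma le_of_tendsto_of_forall_le_add_div {a : ℕ → ℝ} {L r C : ℝ} (ha : Tendsto a atTop (𝓝 L))
    (h : ∀ n : ℕ, 1 ≤ n → a n ≤ r + C / n) : L ≤ r := by
  have h1 : Tendsto (fun n : ℕ => r + C / n) atTop (𝓝 (r + 0)) :=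
    tendsto_const_nhds.add (tendsto_const_div_atTop_nhds_zero_nat C)
  rw [add_zero] at h1
  exact le_of_tendsto_of_tendsto ha h1 ((eventually_ge_atTop 1).mono h)

lemma le_of_tendsto_of_forall_sub_div_le {a : ℕ → ℝ} {L r C : ℝ} (ha : Tendsto a atTop (𝓝 L))
    (h : ∀ n : ℕ, 1 ≤ n → r - C / n ≤ a n) : r ≤ L := by
  have := le_of_tendsto_of_forall_le_add_div (r := -r) (C := C) ha.neg fun n hn => by
    linarith [h n hn]
  linarith

variable [TopologicalSpace α] [DiscreteTopology α] [BorelSpace α]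

lemma IsEqSt.MSeq_eq (hφ : Continuous φ) (hvar : Summable fun n => Var α φ (n + 1))
    (hμ : IsEqSt α φ μ) (q : ℝ) (n : ℕ) :
    MSeq α μ q n = Real.log (partFn μ (1 - q) n) / n := by
  rw [MSeq, partFn, one_div, inv_mul_eq_div]
  congr 2
  refine Finset.sum_congr rfl fun w _ => ?_
  rw [mul_comm]
  exact Real.rpow_def_of_pos (hμ.measureReal_cyl_pos hφ hvar w) _

lemma IsEqSt.log_measureReal_cyl_mem_Icc (hφ : Continuous φ)
    (hvar : Summable fun n => Var α φ (n + 1)) (hμ : IsEqSt α φ μ) {a b : ℝ}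
    (h : ∀ x, φ x ∈ Icc a b) {n : ℕ} (w : Fin n → α) :
    Real.log (μ.real (cyl α w)) ∈ Icc (n * a - tailVar φ 0) (n * b + tailVar φ 0) := by
  have := hμ.1
  obtain ⟨x⟩ := nonempty_of_isProbabilityMeasure μ
  have h1 := abs_le.mp (hμ.abs_log_measureReal_cyl_sub_le hφ hvar (glue_mem_cyl w x))
  have h2 : n * a ≤ birkhoffSum (shift α) φ n (glue w x) := by
    simpa [birkhoffSum] using Finset.card_nsmul_le_sum (Finset.range n)
      (fun i => φ ((shift α)^[i] (glue w x))) a fun i _ => (h _).1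
  have h3 : birkhoffSum (shift α) φ n (glue w x) ≤ n * b := by
    simpa [birkhoffSum] using Finset.sum_le_card_nsmul (Finset.range n)
      (fun i => φ ((shift α)^[i] (glue w x))) b fun i _ => (h _).2
  constructor <;> linarith [h1.1, h1.2]

lemma IsEqSt.exists_tendsto_MSeq [Nonempty α] (hφ : Continuous φ)
    (hvar : Summable fun n => Var α φ (n + 1)) (hμ : IsEqSt α φ μ) (q : ℝ) :
    ∃ L, Tendsto (MSeq α μ q) atTop (𝓝 L) ∧ ∀ n : ℕ,
      n * L - |1 - q| * (3 * tailVar φ 0) ≤ Real.log (partFn μ (1 - q) n) := by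
  set t := 1 - q
  set D := |t| * (3 * tailVar φ 0)
  have hD0 : 0 ≤ D := mul_nonneg (abs_nonneg _) (mul_nonneg (by norm_num) (tailVar_nonneg 0))
  have hpos : ∀ n, 0 < partFn μ t n := fun n => partFn_pos t n
  have hsub : Subadditive fun n => Real.log (partFn μ t n) + D := by
    intro m n
    have h := Real.log_le_log (hpos _) (partFn_add_le (t := t)
      (hμ.abs_log_measureReal_cyl_append_sub_le hφ hvar (m := m) (n := n)))
    rw [Real.log_mul (Real.exp_pos _).ne' (mul_pos (hpos _) (hpos _)).ne', Real.log_exp,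
      Real.log_mul (hpos _).ne' (hpos _).ne'] at h
    linarith
  obtain ⟨B, hB0, hB⟩ := exists_abs_le hφ
  have hlow : ∀ n : ℕ, -(|t| * B) * n ≤ Real.log (partFn μ t n) + D := by
    intro n
    obtain ⟨w⟩ : Nonempty (Fin n → α) := inferInstance
    have h1 : Real.exp (t * Real.log (μ.real (cyl α w))) ≤ partFn μ t n :=
      Finset.single_le_sum (f := fun w : Fin n → α => Real.exp (t * Real.log (μ.real (cyl α w))))
        (fun _ _ => (Real.exp_pos _).le) (Finset.mem_univ w)
    have h2 := (Real.le_log_iff_exp_le (hpos n)).mpr h1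
    have h3 := hμ.log_measureReal_cyl_mem_Icc hφ hvar (fun x => abs_le.mp (hB x)) w
    have h4 : |Real.log (μ.real (cyl α w))| ≤ n * B + tailVar φ 0 :=
      abs_le.mpr ⟨by linarith [h3.1], h3.2⟩
    have h5 := (neg_le_abs _).trans ((abs_mul t _).le.trans
      (mul_le_mul_of_nonneg_left h4 (abs_nonneg t)))
    have h6 : 0 ≤ |t| * tailVar φ 0 := mul_nonneg (abs_nonneg _) (tailVar_nonneg 0)
    linarith
  have hbdd : BddBelow (range fun n : ℕ => (Real.log (partFn μ t n) + D) / n) := by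
    refine ⟨-(|t| * B), ?_⟩
    rintro _ ⟨n, rfl⟩
    rcases Nat.eq_zero_or_pos n with rfl | hn
    · simpa using mul_nonneg (abs_nonneg t) hB0
    · exact (le_div_iff₀ (by exact_mod_cast hn)).mpr (hlow n)
  refine ⟨hsub.lim, ?_, fun n => ?_⟩
  · have h := (hsub.tendsto_lim hbdd).sub (tendsto_const_div_atTop_nhds_zero_nat D)
    rw [sub_zero] at h
    refine h.congr fun n => ?_
    rw [hμ.MSeq_eq hφ hvar, add_div, add_sub_cancel_right]
  · rcases Nat.eq_zero_or_pos n with rfl | hn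
    · have := hlow 0
      simp only [CharP.cast_eq_zero, mul_zero, zero_mul] at this ⊢
      linarith
    · have := hsub.lim_le_div hbdd hn.ne'
      rw [le_div_iff₀ (by exact_mod_cast hn)] at this
      linarith

lemma IsEqSt.MSeq_limit_sub_mem_Icc [Nonempty α] (hφ : Continuous φ)
    (hvar : Summable fun n => Var α φ (n + 1)) (hμ : IsEqSt α φ μ) {a b : ℝ}
    (h : ∀ x, φ x ∈ Icc a b) {q q' L L' : ℝ} (hq : q ≤ q')
    (hL : Tendsto (MSeq α μ q) atTop (𝓝 L)) (hL' : Tendsto (MSeq α μ q') atTop (𝓝 L')) :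
    L' - L ∈ Icc (-b * (q' - q)) (-a * (q' - q)) := by
  have key : ∀ n : ℕ, 1 ≤ n →
      -b * (q' - q) - (q' - q) * tailVar φ 0 / n ≤ MSeq α μ q' n - MSeq α μ q n ∧
      MSeq α μ q' n - MSeq α μ q n ≤ -a * (q' - q) + (q' - q) * tailVar φ 0 / n := by
    intro n hn
    have hn' : (0 : ℝ) < n := by exact_mod_cast hn
    have hs : 0 ≤ q' - q := sub_nonneg.mpr hq
    have h1 := exp_mul_partFn_le (μ := μ) (t := 1 - q) (t' := 1 - q') (n := n)
      (a := (q' - q) * (-(n * b + tailVar φ 0))) (b := (q' - q) * (-(n * a - tailVar φ 0)))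
      fun w => by
        have h2 := hμ.log_measureReal_cyl_mem_Icc hφ hvar h w
        have h3 := mul_le_mul_of_nonneg_left h2.1 hs
        have h4 := mul_le_mul_of_nonneg_left h2.2 hs
        constructor <;> linarith
    have hZ := partFn_pos (μ := μ) (1 - q) n
    have hZ' := partFn_pos (μ := μ) (1 - q') n
    have h5 := Real.log_le_log (mul_pos (Real.exp_pos _) hZ) h1.1
    have h6 := Real.log_le_log hZ' h1.2
    rw [Real.log_mul (Real.exp_pos _).ne' hZ.ne', Real.log_exp] at h5 h6
    rw [hμ.MSeq_eq hφ hvar, hμ.MSeq_eq hφ hvar, ← sub_div]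
    constructor
    · rw [le_div_iff₀ hn', sub_mul, div_mul_cancel₀ _ hn'.ne']
      linarith
    · rw [div_le_iff₀ hn', add_mul, div_mul_cancel₀ _ hn'.ne']
      linarith
  exact ⟨le_of_tendsto_of_forall_sub_div_le (hL'.sub hL) fun n hn => (key n hn).1,
    le_of_tendsto_of_forall_le_add_div (hL'.sub hL) fun n hn => (key n hn).2⟩

lemma IsEqSt.MSeq_limit_zero (hφ : Continuous φ) (hnorm : Normalized α φ) (hμ : IsEqSt α φ μ)
    {L : ℝ} (hL : Tendsto (MSeq α μ 0) atTop (𝓝 L)) : L = 0 := by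
  refine tendsto_nhds_unique hL (tendsto_const_nhds.congr fun n => ?_)
  have := hμ.sum_measureReal_cyl hφ hnorm n
  simp only [measureReal_def] at this
  simp [MSeq, this]

lemma IsEqSt.partFn_two (hφ : Continuous φ) (hvar : Summable fun n => Var α φ (n + 1))
    (hμ : IsEqSt α φ μ) (n : ℕ) :
    partFn μ 2 n = ∑ w : Fin n → α, μ.real (cyl α w) ^ 2 := by
  refine Finset.sum_congr rfl fun w _ => ?_
  rw [two_mul, Real.exp_add, Real.exp_log (hμ.measureReal_cyl_pos hφ hvar w), sq]

lemma IsEqSt.MSeq_limit_neg_one_le [Nonempty α] (hφ : Continuous φ)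
    (hvar : Summable fun n => Var α φ (n + 1)) (hnorm : Normalized α φ) (hμ : IsEqSt α φ μ) {L : ℝ}
    (hL : Tendsto (MSeq α μ (-1)) atTop (𝓝 L)) : L ≤ supInt α φ := by
  refine le_of_tendsto_of_forall_le_add_div (C := 2 * tailVar φ 0) hL fun n hn => ?_
  have hn' : (0 : ℝ) < n := by exact_mod_cast hn
  have := hμ.1
  obtain ⟨x⟩ := nonempty_of_isProbabilityMeasure μ
  have h2 : (1 : ℝ) - -1 = 2 := by norm_num
  rw [hμ.MSeq_eq hφ hvar, h2, div_le_iff₀ hn', add_mul, div_mul_cancel₀ _ hn'.ne',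
    Real.log_le_iff_le_exp (partFn_pos _ _), hμ.partFn_two hφ hvar,
    ← mul_one (Real.exp _), ← hμ.sum_measureReal_cyl hφ hnorm n, Finset.mul_sum]
  refine Finset.sum_le_sum fun w _ => ?_
  rw [sq]
  refine mul_le_mul_of_nonneg_right ?_ measureReal_nonneg
  refine (hμ.measureReal_cyl_mem_Icc hφ hvar (glue_mem_cyl w x)).2.trans (Real.exp_le_exp.mpr ?_)
  linarith [birkhoffSum_le_supInt hφ hvar n (glue w x)]

lemma IsEqSt.neg_log_card_le_MSeq_limit_neg_one [Nonempty α] (hφ : Continuous φ)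
    (hvar : Summable fun n => Var α φ (n + 1)) (hnorm : Normalized α φ) (hμ : IsEqSt α φ μ) {L : ℝ}
    (hL : Tendsto (MSeq α μ (-1)) atTop (𝓝 L)) : -Real.log (Fintype.card α) ≤ L := by
  refine le_of_tendsto_of_forall_sub_div_le (C := 0) hL fun n hn => ?_
  have hn' : (0 : ℝ) < n := by exact_mod_cast hn
  have hc : (0 : ℝ) < Fintype.card α := by exact_mod_cast Fintype.card_pos
  have h2 : (1 : ℝ) - -1 = 2 := by norm_num
  rw [hμ.MSeq_eq hφ hvar, h2, zero_div, sub_zero, le_div_iff₀ hn',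
    Real.le_log_iff_exp_le (partFn_pos _ _), hμ.partFn_two hφ hvar, neg_mul, Real.exp_neg,
    mul_comm, Real.exp_nat_mul, Real.exp_log hc, inv_le_iff_one_le_mul₀' (pow_pos hc n)]
  have h := sq_sum_le_card_mul_sum_sq (s := Finset.univ)
    (f := fun w : Fin n → α => μ.real (cyl α w))
  rw [hμ.sum_measureReal_cyl hφ hnorm n] at h
  simpa using h

end Spectrum

section SubAction

variable {α : Type*} [Fintype α] [TopologicalSpace α] [DiscreteTopology α] {φ : X α → ℝ}

/-- A potential whose Birkhoff averages are at most `a`, up to a bounded error, admits a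
continuous sub-action. -/
lemma exists_subaction (hφ : Continuous φ) (hvar : Summable fun n => Var α φ (n + 1)) {a C : ℝ}
    (h : ∀ n x, birkhoffSum (shift α) φ n x ≤ n * a + C) :
    ∃ u : X α → ℝ, Continuous u ∧ (∀ x, u x ∈ Icc 0 C) ∧
      ∀ x, u x + φ x - a ≤ u (shift α x) := by
  let s : X α → (Σ n : ℕ, Fin n → α) → ℝ :=
    fun x p => birkhoffSum (shift α) φ p.1 (glue p.2 x) - p.1 * a
  have hs : ∀ x p, s x p ≤ C := fun x p => by linarith [h p.1 (glue p.2 x)]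
  have hbdd : ∀ x, BddAbove (range (s x)) := fun x => ⟨C, by rintro _ ⟨p, rfl⟩; exact hs x p⟩
  have : Nonempty (Σ n : ℕ, Fin n → α) := ⟨⟨0, Fin.elim0⟩⟩
  have hle : ∀ k x y, (∀ i < k, x i = y i) → (⨆ p, s x p) - (⨆ p, s y p) ≤ tailVar φ k := by
    intro k x y hxy
    rw [sub_le_iff_le_add]
    refine ciSup_le fun p => ?_
    have h1 := (abs_le.mp (abs_birkhoffSum_sub_le hφ hvar (glue_eq_of_lt p.2 hxy))).2
    have h2 : s y p ≤ ⨆ p, s y p := le_ciSup (hbdd y) p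
    simp only [s] at h1 h2 ⊢
    linarith
  refine ⟨fun x => ⨆ p, s x p, continuous_of_modulus (tendsto_tailVar (φ := φ)) fun k x y hxy => ?_,
    fun x => ⟨?_, ciSup_le (hs x)⟩, fun x => ?_⟩
  · exact abs_sub_le_iff.mpr ⟨hle k x y hxy, hle k y x fun i hi => (hxy i hi).symm⟩
  · refine le_ciSup_of_le (hbdd x) ⟨0, Fin.elim0⟩ ?_
    simp [s]
  · rw [add_sub_assoc, ← le_sub_iff_add_le]
    refine ciSup_le fun p => ?_
    rw [le_sub_iff_add_le]
    obtain ⟨n, w⟩ := p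
    refine le_ciSup_of_le (hbdd _) ⟨n + 1, fun i => glue w x i⟩ ?_
    have h1 : glue (fun i : Fin (n + 1) => glue w x i) (shift α x) = glue w x := by
      conv_rhs => rw [← glue_shift_iterate (n + 1) (glue w x), Function.iterate_succ_apply',
        shift_iterate_glue]
    simp only [s]
    rw [h1, birkhoffSum_succ, shift_iterate_glue]
    push_cast
    linarith

variable [MeasurableSpace α] [BorelSpace α] {μ : Measure (X α)}

lemma IsEqSt.integral_exp_neg_birkhoffSum_add_le (hφ : Continuous φ) (hμ : IsEqSt α φ μ)
    {χ : X α → ℝ} (hχ : Continuous χ) {k : ℕ} {ρ : ℝ}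
    (hρ : ∀ x, ∑ w : Fin k → α, Real.exp (birkhoffSum (shift α) φ k (glue w x)) *
      Real.exp (-birkhoffSum (shift α) χ k (glue w x)) ≤ ρ) (n : ℕ) :
    ∫ x, Real.exp (-birkhoffSum (shift α) χ (k + n) x) ∂μ ≤
      ρ * ∫ x, Real.exp (-birkhoffSum (shift α) χ n x) ∂μ := by
  have := hμ.1
  have hc : ∀ n, Continuous fun x => Real.exp (-birkhoffSum (shift α) χ n x) :=
    fun n => (continuous_birkhoffSum_shift hχ n).neg.rexp
  have hc' : ∀ w : Fin k → α, Continuous fun x =>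
      Real.exp (birkhoffSum (shift α) φ k (glue w x)) *
        Real.exp (-birkhoffSum (shift α) χ (k + n) (glue w x)) := fun w =>
    ((continuous_birkhoffSum_shift hφ k).comp (continuous_glue w)).rexp.mul
      ((hc (k + n)).comp (continuous_glue w))
  rw [hμ.integral_eq_sum hφ k (hc _),
    ← integral_finsetSum _ fun w _ => integrable_of_continuous (hc' w), ← integral_const_mul]
  refine integral_mono (integrable_of_continuous (continuous_finsetSum _ fun w _ => hc' w))
    (integrable_of_continuous ((hc n).const_mul ρ)) fun x => ?_
  simp only
  refine le_of_eq_of_le ?_ (mul_le_mul_of_nonneg_right (hρ x) (Real.exp_pos _).le)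
  rw [Finset.sum_mul]
  refine Finset.sum_congr rfl fun w _ => ?_
  rw [birkhoffSum_add, shift_iterate_glue, neg_add, Real.exp_add, mul_assoc]

/-- The integrals of `exp (-S_n χ)` are not bounded away from zero if `χ ≥ 0` is non-zero. -/
lemma IsEqSt.exists_integral_exp_neg_birkhoffSum_lt (hφ : Continuous φ) (hnorm : Normalized α φ)
    (hμ : IsEqSt α φ μ) {χ : X α → ℝ} (hχ : Continuous χ) (hχ0 : ∀ x, 0 ≤ χ x) {x₀ : X α}
    (hx₀ : 0 < χ x₀) {ε : ℝ} (hε : 0 < ε) :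
    ∃ n, ∫ x, Real.exp (-birkhoffSum (shift α) χ n x) ∂μ < ε := by
  have := hμ.1
  obtain ⟨k, hk, δ, hδ, hχδ⟩ := exists_cyl_lt_of_pos hχ hx₀
  obtain ⟨B, -, hB⟩ := exists_abs_le hφ
  set w₀ : Fin k → α := fun i => x₀ i
  set ρ := 1 - Real.exp (k * -B) * (1 - Real.exp (-δ)) with hρ_def
  have hδ1 : 0 < 1 - Real.exp (-δ) := by
    rw [sub_pos, Real.exp_lt_one_iff]
    linarith
  have hρ1 : ρ < 1 := by
    have := mul_pos (Real.exp_pos (k * -B)) hδ1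
    linarith
  have hS0 : ∀ n y, 0 ≤ birkhoffSum (shift α) χ n y :=
    fun n y => Finset.sum_nonneg fun i _ => hχ0 _
  have hρ : ∀ x, ∑ w : Fin k → α, Real.exp (birkhoffSum (shift α) φ k (glue w x)) *
      Real.exp (-birkhoffSum (shift α) χ k (glue w x)) ≤ ρ := by
    intro x
    have h1 : Real.exp (k * -B) * (1 - Real.exp (-δ)) ≤
        ∑ w : Fin k → α, Real.exp (birkhoffSum (shift α) φ k (glue w x)) *
          (1 - Real.exp (-birkhoffSum (shift α) χ k (glue w x))) := by
      refine le_trans ?_ (Finset.single_le_sum (f := fun w : Fin k → α =>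
        Real.exp (birkhoffSum (shift α) φ k (glue w x)) *
          (1 - Real.exp (-birkhoffSum (shift α) χ k (glue w x)))) (fun w _ => ?_)
        (Finset.mem_univ w₀))
      · refine mul_le_mul (Real.exp_le_exp.mpr ?_) (sub_le_sub_left (Real.exp_le_exp.mpr
          (neg_le_neg ?_)) _) hδ1.le (Real.exp_pos _).le
        · simpa [birkhoffSum] using Finset.card_nsmul_le_sum (Finset.range k)
            (fun i => φ ((shift α)^[i] (glue w₀ x))) (-B) fun i _ => (abs_le.mp (hB _)).1
        · refine (hχδ _ (glue_mem_cyl w₀ x)).trans ?_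
          exact Finset.single_le_sum (f := fun i => χ ((shift α)^[i] (glue w₀ x)))
            (fun i _ => hχ0 _) (Finset.mem_range.mpr hk)
      · refine mul_nonneg (Real.exp_pos _).le (sub_nonneg.mpr (Real.exp_le_one_iff.mpr ?_))
        exact neg_nonpos.mpr (hS0 _ _)
    simp only [mul_sub, mul_one, Finset.sum_sub_distrib, sum_exp_birkhoffSum_glue hnorm] at h1
    rw [hρ_def]
    linarith
  have hρ0 : 0 ≤ ρ := (Finset.sum_nonneg fun w _ =>
    mul_nonneg (Real.exp_pos _).le (Real.exp_pos _).le).trans (hρ x₀)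
  have hpow : ∀ j : ℕ, ∫ x, Real.exp (-birkhoffSum (shift α) χ (k * j) x) ∂μ ≤ ρ ^ j := by
    intro j
    induction j with
    | zero => simp
    | succ j ih =>
      rw [Nat.mul_succ, add_comm, pow_succ']
      exact (hμ.integral_exp_neg_birkhoffSum_add_le hφ hχ hρ _).trans
        (mul_le_mul_of_nonneg_left ih hρ0)
  obtain ⟨j, hj⟩ := exists_pow_lt_of_lt_one hε hρ1
  exact ⟨k * j, (hpow j).trans_lt hj⟩

end SubAction

section Rigidity

variable {α : Type*} [Fintype α] [TopologicalSpace α] [DiscreteTopology α]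
  [MeasurableSpace α] [BorelSpace α] {φ : X α → ℝ} {μ : Measure (X α)}

omit [Fintype α] [TopologicalSpace α] [DiscreteTopology α] [MeasurableSpace α] [BorelSpace α] in
lemma birkhoffSum_coboundary (u : X α → ℝ) (a : ℝ) (n : ℕ) (x : X α) :
    birkhoffSum (shift α) (fun x => u (shift α x) - u x - φ x + a) n x =
      u ((shift α)^[n] x) - u x - birkhoffSum (shift α) φ n x + n * a := by
  induction n with
  | zero => simp
  | succ n ih =>
    rw [birkhoffSum_succ, birkhoffSum_succ, ih, ← Function.iterate_succ_apply' (shift α)]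
    push_cast
    ring

/-- If the `L²`-spectrum of `μ` is as small as `sup_η ∫ φ dη` allows, then `φ` is cohomologous to
the constant `sup_η ∫ φ dη`. -/
lemma IsEqSt.exists_eq_supInt_add_coboundary [Nonempty α] (hφ : Continuous φ)
    (hvar : Summable fun n => Var α φ (n + 1)) (hnorm : Normalized α φ) (hμ : IsEqSt α φ μ)
    (h : Tendsto (MSeq α μ (-1)) atTop (𝓝 (supInt α φ))) :
    ∃ u : X α → ℝ, Continuous u ∧ (∀ x, u x ∈ Icc 0 (tailVar φ 0)) ∧
      ∀ x, φ x = supInt α φ + u (shift α x) - u x := by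
  have := hμ.1
  obtain ⟨L, hL, hL'⟩ := hμ.exists_tendsto_MSeq hφ hvar (-1)
  rw [tendsto_nhds_unique hL h] at hL'
  obtain ⟨u, hu, hu0, hsub⟩ := exists_subaction hφ hvar (birkhoffSum_le_supInt hφ hvar)
  refine ⟨u, hu, hu0, ?_⟩
  set a := supInt α φ
  set c := tailVar φ 0
  set χ : X α → ℝ := fun x => u (shift α x) - u x - φ x + a with hχ_def
  have hχ : Continuous χ := (((hu.comp continuous_shift).sub hu).sub hφ).add continuous_const
  have hχ0 : ∀ x, 0 ≤ χ x := fun x => by linarith [hsub x]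
  have hχ1 : ∀ x, χ x ≤ 0 := by
    intro x
    by_contra! hx
    obtain ⟨n, hn⟩ := hμ.exists_integral_exp_neg_birkhoffSum_lt hφ hnorm hχ hχ0 hx
      (Real.exp_pos (-(9 * c)))
    refine hn.not_ge ?_
    have h2 : (1 : ℝ) - -1 = 2 := by norm_num
    have hZ := hL' n
    rw [h2, Real.le_log_iff_exp_le (partFn_pos _ _)] at hZ
    have hsum : Real.exp (-(3 * c + n * a)) * partFn μ 2 n ≤
        ∫ x, Real.exp (-birkhoffSum (shift α) χ n x) ∂μ := by
      have hf : Continuous fun x => Real.exp (-birkhoffSum (shift α) χ n x) :=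
        (continuous_birkhoffSum_shift hχ n).neg.rexp
      rw [hμ.integral_eq_sum hφ n hf, partFn, Finset.mul_sum]
      refine Finset.sum_le_sum fun w _ => ?_
      simp_rw [← Real.exp_add]
      refine (integral_mem_Icc (b := Real.exp (n * a + c)) ?_ (fun y => ?_) fun y => ?_).1
      · exact (((continuous_birkhoffSum_shift hφ n).comp (continuous_glue w)).add
          ((continuous_birkhoffSum_shift hχ n).comp (continuous_glue w)).neg).rexp
      · rw [Real.exp_le_exp, birkhoffSum_coboundary]
        have h3 := (abs_le.mp (hμ.abs_log_measureReal_cyl_sub_le hφ hvar (glue_mem_cyl w y))).2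
        linarith [(hu0 (glue w y)).1, (hu0 ((shift α)^[n] (glue w y))).2]
      · rw [Real.exp_le_exp]
        have h3 : 0 ≤ birkhoffSum (shift α) χ n (glue w y) := Finset.sum_nonneg fun i _ => hχ0 _
        linarith [birkhoffSum_le_supInt hφ hvar n (glue w y)]
    refine le_trans ?_ hsum
    refine le_trans (le_of_eq ?_) (mul_le_mul_of_nonneg_left hZ (Real.exp_pos _).le)
    rw [← Real.exp_add, abs_two]
    congr 1
    ring
  intro x
  have := le_antisymm (hχ1 x) (hχ0 x)
  simp only [hχ_def] at this
  linarith

lemma IsEqSt.supInt_le_neg_log_card [Nonempty α] (hφ : Continuous φ)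
    (hvar : Summable fun n => Var α φ (n + 1)) (hnorm : Normalized α φ) (hμ : IsEqSt α φ μ)
    {C : ℝ} (h : ∀ n x, n * supInt α φ - C ≤ birkhoffSum (shift α) φ n x) :
    supInt α φ ≤ -Real.log (Fintype.card α) := by
  have := hμ.1
  obtain ⟨x⟩ := nonempty_of_isProbabilityMeasure μ
  have hc : (0 : ℝ) < Fintype.card α := by exact_mod_cast Fintype.card_pos
  refine le_of_tendsto_of_forall_le_add_div (C := C + tailVar φ 0) tendsto_const_nhds
    fun n hn => ?_
  have hn' : (0 : ℝ) < n := by exact_mod_cast hn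
  have h1 : ∑ w : Fin n → α, Real.exp (n * supInt α φ - C - tailVar φ 0) ≤ 1 := by
    rw [← hμ.sum_measureReal_cyl hφ hnorm n]
    refine Finset.sum_le_sum fun w _ => ?_
    refine le_trans (Real.exp_le_exp.mpr ?_)
      (hμ.measureReal_cyl_mem_Icc hφ hvar (glue_mem_cyl w x)).1
    linarith [h n (glue w x)]
  rw [Finset.sum_const, Finset.card_univ, Fintype.card_fun, Fintype.card_fin, nsmul_eq_mul,
    Nat.cast_pow, ← Real.exp_log hc, ← Real.exp_nat_mul, ← Real.exp_add,
    Real.exp_le_one_iff] at h1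
  rw [← sub_le_iff_le_add', le_div_iff₀ hn']
  linarith

lemma integral_eq_neg_of_coboundary {u : X α → ℝ} (hu : Continuous u) {a : ℝ}
    (h : ∀ x, φ x = u x - u (shift α x) - a) {η : Measure (X α)} (hη : InvProb α η) :
    ∫ x, φ x ∂η = -a := by
  have := hη.1
  have hinv : ∫ x, u (shift α x) ∂η = ∫ x, u x ∂η := by
    conv_rhs => rw [← hη.2]
    exact (integral_map measurable_shift.aemeasurable
      hu.measurable.aestronglyMeasurable).symm
  have h1 : Integrable u η := integrable_of_continuous hu
  have h2 : Integrable (fun x => u (shift α x)) η :=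
    integrable_of_continuous (hu.comp continuous_shift)
  have h3 : Integrable (fun x => u x - u (shift α x)) η := h1.sub h2
  simp_rw [h]
  rw [integral_sub h3 (integrable_const a), integral_sub h1 h2, hinv]
  simp

end Rigidity

/-- for a normalized potential `φ` with summable variation with
equilibrium state `μ_φ`, the `L^q`-spectrum `M_{μ_φ}(q)` exists for every `q`, the
equation `M_{μ_φ}(q) = sup_η ∫ φ dη` has a unique solution `q*_φ`, `q*_φ ∈ [-1, 0)`,
and `q*_φ = -1` iff `φ = u - u∘θ - log|A|` for some continuous `u`. -/
theorem critical_exponent_exists_unique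
    (hcard : 1 < Fintype.card A)
    (φ : X A → ℝ) (hφc : Continuous φ)
    (hvar : Summable (fun n => Var A φ (n + 1)))
    (hnorm : Normalized A φ)
    (μφ : Measure (X A)) (hμ : IsEqSt A φ μφ) :
    ∃ M : ℝ → ℝ, (∀ q : ℝ, Tendsto (MSeq A μφ q) atTop (nhds (M q))) ∧
      ∃ qs : ℝ, M qs = supInt A φ ∧ (∀ q : ℝ, M q = supInt A φ → q = qs) ∧
        qs ∈ Set.Ico (-1 : ℝ) 0 ∧
        (qs = -1 ↔ ∃ u : X A → ℝ, Continuous u ∧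
          ∀ x, φ x = u x - u (shift A x) - Real.log (Fintype.card A)) := by
  have : Nonempty A := Fintype.card_pos_iff.mp (by omega)
  obtain ⟨δ, hδ, hφδ⟩ := exists_forall_le_neg hcard hφc hnorm
  obtain ⟨B, -, hB⟩ := exists_abs_le hφc
  have hmem : ∀ x, φ x ∈ Icc (-B) (-δ) := fun x => ⟨(abs_le.mp (hB x)).1, hφδ x⟩
  choose M hM _ using hμ.exists_tendsto_MSeq hφc hvar
  have hsub : ∀ {q q'}, q ≤ q' → M q' - M q ∈ Icc (δ * (q' - q)) (B * (q' - q)) :=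
    fun {q q'} hq => by
      simpa using hμ.MSeq_limit_sub_mem_Icc hφc hvar hmem hq (hM q) (hM q')
  have hmono : StrictMono M := fun q q' hq => by
    have := (hsub hq.le).1
    linarith [mul_pos hδ (sub_pos.mpr hq)]
  have hcont : Continuous M := by
    refine (LipschitzWith.of_le_add_mul (Real.toNNReal B) fun q q' => ?_).continuous
    have hBδ : 0 ≤ (Real.toNNReal B : ℝ) * dist q q' := by positivity
    rcases le_total q q' with h | h
    · linarith [hmono.monotone h]
    · have h1 := mul_le_mul_of_nonneg_right (Real.le_coe_toNNReal B) (sub_nonneg.mpr h)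
      rw [Real.dist_eq, abs_of_nonneg (sub_nonneg.mpr h)]
      linarith [(hsub h).2]
  have hM0 : M 0 = 0 := hμ.MSeq_limit_zero hφc hnorm (hM 0)
  have hneg : supInt A φ < 0 := by
    refine lt_of_le_of_lt (supInt_le fun η hη => ?_) (neg_neg_of_pos hδ)
    have := hη.1
    exact (integral_mem_Icc hφc (fun x => (hmem x).1) fun x => (hmem x).2).2
  have hM1 : M (-1) ≤ supInt A φ := hμ.MSeq_limit_neg_one_le hφc hvar hnorm (hM (-1))
  obtain ⟨qs, hqs, hqs'⟩ := intermediate_value_Icc (by norm_num : (-1 : ℝ) ≤ 0)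
    hcont.continuousOn (show supInt A φ ∈ Icc (M (-1)) (M 0) from ⟨hM1, by linarith⟩)
  have huniq : ∀ q, M q = supInt A φ → q = qs := fun q hq => hmono.injective (hq.trans hqs'.symm)
  refine ⟨M, hM, qs, hqs', huniq, ⟨hqs.1, lt_of_le_of_ne hqs.2 ?_⟩, ?_, ?_⟩
  · rintro rfl
    linarith
  · rintro rfl
    obtain ⟨u, hu, hu0, hφu⟩ := hμ.exists_eq_supInt_add_coboundary hφc hvar hnorm
      (hqs' ▸ hM (-1))
    have hcard_le : supInt A φ ≤ -Real.log (Fintype.card A) := by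
      refine hμ.supInt_le_neg_log_card hφc hvar hnorm (C := tailVar φ 0) fun n x => ?_
      have h1 := birkhoffSum_coboundary (φ := φ) u (supInt A φ) n x
      have h2 : birkhoffSum (shift A) (fun x => u (shift A x) - u x - φ x + supInt A φ) n x = 0 :=
        Finset.sum_eq_zero fun i _ => by
          simp only
          linarith [hφu ((shift A)^[i] x)]
      linarith [(hu0 ((shift A)^[n] x)).1, (hu0 x).2]
    have hcard_ge := hμ.neg_log_card_le_MSeq_limit_neg_one hφc hvar hnorm (hM (-1))
    refine ⟨fun x => -u x, hu.neg, fun x => ?_⟩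
    linarith [hφu x]
  · rintro ⟨u, hu, hφu⟩
    refine (huniq (-1) (le_antisymm hM1 ?_)).symm
    refine le_trans (supInt_le fun η hη => ?_)
      (hμ.neg_log_card_le_MSeq_limit_neg_one hφc hvar hnorm (hM (-1)))
    exact (integral_eq_neg_of_coboundary hu hφu hη).le

end RTSpec
end
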